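/- arXiv:1201.6576 — 2 statements merged into one kernel-verified Lean document; each statement's English description precedes it below -/
import Mathlib

section
/- Let n ≥ 1 and let s, r_1, r_2, …, r_n be nonnegative integers with s + r_1 + 2r_2 + … + n·r_n = n, and set m = r_1 + … + r_n. Then the number of partitions π in NC_B(n) having exactly r_i unordered pairs {V, −V} of non-zero blocks with |V| = i for each i, and whose zero-block has cardinality 2s (where s = 0 means π has no zero-block), equals n! / (r_1!·r_2!⋯r_n!·(n − m)!); equivalently, (that number)·r_1!⋯r_n!·(n − m)! = n!. -/
open Finset

/-- A finpartition of a linearly ordered set is non-crossing if there are no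
`a < b < c < d` with `a, c` in one block and `b, d` in a different block. -/
def IsNoncrossing {n : ℕ} (π : Finpartition (Finset.univ : Finset (Fin n))) : Prop :=
  ∀ a b c d : Fin n, a < b → b < c → c < d →
    ∀ B ∈ π.parts, ∀ C ∈ π.parts, a ∈ B → c ∈ B → b ∈ C → d ∈ C → B = C

/-- Filter by an arbitrary (possibly non-decidable) predicate. -/
noncomputable def fil {α : Type*} (s : Finset α) (p : α → Prop) : Finset α :=
  letI := Classical.decPred p
  s.filter p

/-- Negation on `[±n] = {1,…,n,-1,…,-n}`, identified with `Fin (2n)` via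
`i ↦ i - 1` and `-i ↦ n + i - 1` (zero-based).  It is given by adding `n` modulo `2n`. -/
def negB {n : ℕ} (x : Fin (2 * n)) : Fin (2 * n) :=
  ⟨(x.val + n) % (2 * n), Nat.mod_lt _ (by have := x.isLt; omega)⟩

/-- `-V` for a block `V`. -/
def negBlock {n : ℕ} (V : Finset (Fin (2 * n))) : Finset (Fin (2 * n)) :=
  V.image negB

/-- `NCB n` : non-crossing partitions of type `B_n`, i.e. non-crossing partitions
of `[±n]` such that `-V` is a block whenever `V` is, with at most one block `V`
satisfying `-V = V` (the zero-block). -/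
noncomputable def NCB (n : ℕ) : Finset (Finpartition (Finset.univ : Finset (Fin (2 * n)))) :=
  fil Finset.univ (fun π => IsNoncrossing π ∧ (∀ B ∈ π.parts, negBlock B ∈ π.parts) ∧
    (π.parts.filter (fun B => negBlock B = B)).card ≤ 1)

/-- The number of unordered pairs `{V, -V}` of non-zero blocks of `π` with `|V| = t`. -/
def pairCount {n : ℕ} (π : Finpartition (Finset.univ : Finset (Fin (2 * n)))) (t : ℕ) : ℕ :=
  (π.parts.filter (fun B => negBlock B ≠ B ∧ B.card = t)).card / 2

/-- The number of unordered pairs `{V, -V}` of non-zero blocks of `π` (of any size). -/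
def totalPairCount {n : ℕ} (π : Finpartition (Finset.univ : Finset (Fin (2 * n)))) : ℕ :=
  (π.parts.filter (fun B => negBlock B ≠ B)).card / 2

/-- The cardinality of the zero-block of `π` (`0` if there is no zero-block). -/
def zeroBlockSize {n : ℕ} (π : Finpartition (Finset.univ : Finset (Fin (2 * n)))) : ℕ :=
  ∑ B ∈ π.parts.filter (fun B => negBlock B = B), B.card

/-- `NCBdiv k n` : the `k`-divisible non-crossing partitions of type `B_{kn}`. -/
noncomputable def NCBdiv (k n : ℕ) :
    Finset (Finpartition (Finset.univ : Finset (Fin (2 * (k * n))))) :=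
  fil (NCB (k * n)) (fun π => ∀ B ∈ π.parts, k ∣ B.card)

/-! ### Opener relations on the integers -/

/-- An opener relation: `Op i x` says that `i` is the first element of the (lifted) nonzero
block containing `x`. -/
structure IsOp (n : ℕ) (Op : ℤ → ℤ → Prop) : Prop where
  le : ∀ i x, Op i x → i ≤ x
  lt : ∀ i x, Op i x → x < i + n
  uniq : ∀ i j x, Op i x → Op j x → i = j
  nest : ∀ i x y, Op i x → i ≤ y → y ≤ x → ∃ j, i ≤ j ∧ Op j y
  per : ∀ i x, Op (i + n) (x + n) ↔ Op i x

open Classical in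
/-- Size of the block opened at `t`. -/
noncomputable def opSize (n : ℕ) (Op : ℤ → ℤ → Prop) (t : ℤ) : ℕ :=
  ((Finset.Ico t (t + n)).filter (fun y => Op t y)).card

/-- Height function. -/
noncomputable def hgt (f : ℤ → ℕ) (x : ℤ) : ℤ :=
  ∑ t ∈ Finset.Ico 0 x, ((f t : ℤ) - 1) - ∑ t ∈ Finset.Ico x 0, ((f t : ℤ) - 1)

/-- The opener relation determined by a size function. -/
def opOf (f : ℤ → ℕ) (i x : ℤ) : Prop :=
  i ≤ x ∧ hgt f i ≤ hgt f (x + 1) ∧ ∀ j, i < j → j ≤ x → hgt f (x + 1) < hgt f j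

lemma hgt_succ (f : ℤ → ℕ) (x : ℤ) : hgt f (x + 1) = hgt f x + f x - 1 := by
  unfold hgt
  rcases le_or_gt 0 x with h | h
  · have h1 : Finset.Ico (0:ℤ) (x + 1) = insert x (Finset.Ico 0 x) := by
      ext y; simp; omega
    have h2 : Finset.Ico (x + 1) (0:ℤ) = ∅ := by ext y; simp; omega
    have h3 : Finset.Ico x (0:ℤ) = ∅ := by ext y; simp; omega
    rw [h1, h2, h3, Finset.sum_insert (by simp)]
    simp; ring
  · have h1 : Finset.Ico x (0:ℤ) = insert x (Finset.Ico (x + 1) 0) := by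
      ext y; simp; omega
    have h2 : Finset.Ico (0:ℤ) (x + 1) = ∅ := by ext y; simp; omega
    have h3 : Finset.Ico (0:ℤ) x = ∅ := by ext y; simp; omega
    rw [h1, h2, h3, Finset.sum_insert (by simp)]
    simp; ring

lemma hgt_add (f : ℤ → ℕ) (a : ℤ) (k : ℕ) :
    hgt f (a + k) = hgt f a + ∑ t ∈ Finset.Ico a (a + k), (f t : ℤ) - k := by
  induction k with
  | zero => simp
  | succ k ih =>
    have h1 : Finset.Ico a (a + (k + 1 : ℕ)) = insert (a + k) (Finset.Ico a (a + k)) := by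
      ext y; simp; omega
    rw [h1, Finset.sum_insert (by simp)]
    push_cast
    rw [← add_assoc, hgt_succ, ih]; ring

lemma hgt_diff (f : ℤ → ℕ) (a b : ℤ) (h : a ≤ b) :
    hgt f b = hgt f a + ∑ t ∈ Finset.Ico a b, (f t : ℤ) - (b - a) := by
  obtain ⟨k, rfl⟩ := Int.le.dest h
  rw [hgt_add]; ring

lemma hgt_per (n : ℕ) (f : ℤ → ℕ) (hf : ∀ t, f (t + n) = f t) (x : ℤ) :
    hgt f (x + n) = hgt f x + hgt f n := by
  induction x with
  | zero => simp [hgt]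
  | succ k ih =>
    have : (k:ℤ) + 1 + n = (k + n) + 1 := by ring
    rw [this, hgt_succ, hgt_succ, ih, hf]; ring
  | pred k ih =>
    have h1 := hgt_succ f (-k - 1 + n)
    have h2 := hgt_succ f (-k - 1)
    rw [hf] at h1
    have e1 : -(k:ℤ) - 1 + n + 1 = -k + n := by ring
    have e2 : -(k:ℤ) - 1 + 1 = -k := by ring
    rw [e1] at h1; rw [e2] at h2
    omega

lemma opSize_per (n : ℕ) (Op : ℤ → ℤ → Prop) (h : IsOp n Op) (t : ℤ) :
    opSize n Op (t + n) = opSize n Op t := by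
  classical
  unfold opSize
  symm
  apply Finset.card_bij (fun (y : ℤ) _ => y + (n : ℤ))
  · intro y hy
    simp only [Finset.mem_filter, Finset.mem_Ico] at hy ⊢
    exact ⟨by omega, (h.per _ _).2 hy.2⟩
  · intro y _ z _ e; omega
  · intro y hy
    simp only [Finset.mem_filter, Finset.mem_Ico] at hy
    refine ⟨y - n, ?_, by ring⟩
    simp only [Finset.mem_filter, Finset.mem_Ico]
    refine ⟨by omega, (h.per _ _).1 ?_⟩
    simpa using hy.2

open Classical in
/-- Sum of block sizes over an interval of openers. -/
lemma sum_opSize (n : ℕ) (Op : ℤ → ℤ → Prop) (h : IsOp n Op) (a b : ℤ) :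
    ∑ t ∈ Finset.Ico a b, opSize n Op t =
      ((Finset.Ico a (b + n)).filter (fun y => ∃ t, a ≤ t ∧ t < b ∧ Op t y)).card := by
  have : (Finset.Ico a (b + n)).filter (fun y => ∃ t, a ≤ t ∧ t < b ∧ Op t y) =
      (Finset.Ico a b).biUnion (fun t => (Finset.Ico t (t + n)).filter (fun y => Op t y)) := by
    ext y
    simp only [Finset.mem_filter, Finset.mem_biUnion, Finset.mem_Ico]
    constructor
    · rintro ⟨_, t, h1, h2, h3⟩
      exact ⟨t, ⟨h1, h2⟩, ⟨h.le _ _ h3, h.lt _ _ h3⟩, h3⟩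
    · rintro ⟨t, ⟨h1, h2⟩, h4, h3⟩
      exact ⟨by omega, t, h1, h2, h3⟩
  rw [this, Finset.card_biUnion]
  · rfl
  · intro t _ t' _ hne
    rw [Function.onFun, Finset.disjoint_left]
    intro y hy hy'
    simp only [Finset.mem_filter] at hy hy'
    exact hne (h.uniq _ _ _ hy.2 hy'.2)

lemma IsOp.refl {n : ℕ} {Op : ℤ → ℤ → Prop} (h : IsOp n Op) {i x : ℤ} (hx : Op i x) :
    Op i i := by
  obtain ⟨j, h1, h2⟩ := h.nest i x i hx le_rfl (h.le _ _ hx)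
  have := h.le _ _ h2
  have : j = i := by omega
  rwa [this] at h2

lemma IsOp.hgt_ge {n : ℕ} {Op : ℤ → ℤ → Prop} (h : IsOp n Op) {i x : ℤ} (hx : Op i x) :
    hgt (opSize n Op) i ≤ hgt (opSize n Op) (x + 1) := by
  classical
  have hle := h.le _ _ hx
  have hlt := h.lt _ _ hx
  rw [hgt_diff _ i (x + 1) (by omega)]
  have := sum_opSize n Op h i (x + 1)
  have h2 : (Finset.Ico i (x + 1)).card ≤ ((Finset.Ico i (x + 1 + n)).filter
      (fun y => ∃ t, i ≤ t ∧ t < x + 1 ∧ Op t y)).card := by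
    apply Finset.card_le_card
    intro y hy
    simp only [Finset.mem_filter, Finset.mem_Ico] at hy ⊢
    refine ⟨by omega, ?_⟩
    obtain ⟨j, h1, h2⟩ := h.nest i x y hx (by omega) (by omega)
    have := h.le _ _ h2
    exact ⟨j, h1, by omega, h2⟩
  rw [← this, Int.card_Ico] at h2
  have h3 : ((∑ t ∈ Finset.Ico i (x + 1), opSize n Op t : ℕ) : ℤ) ≥ x + 1 - i := by omega
  push_cast at h3
  omega

lemma IsOp.hgt_lt {n : ℕ} {Op : ℤ → ℤ → Prop} (h : IsOp n Op) {j x : ℤ} (hj : j ≤ x)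
    (hx : ∀ i, j ≤ i → ¬ Op i x) :
    hgt (opSize n Op) (x + 1) < hgt (opSize n Op) j := by
  classical
  rw [hgt_diff _ j (x + 1) (by omega)]
  have := sum_opSize n Op h j (x + 1)
  have h2 : ((Finset.Ico j (x + 1 + n)).filter
      (fun y => ∃ t, j ≤ t ∧ t < x + 1 ∧ Op t y)).card ≤ (Finset.Ico j x).card := by
    apply Finset.card_le_card
    intro y hy
    simp only [Finset.mem_filter, Finset.mem_Ico] at hy ⊢
    obtain ⟨_, t, h1, h2, h3⟩ := hy
    refine ⟨by omega, ?_⟩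
    by_contra hc
    obtain ⟨k, h4, h5⟩ := h.nest t y x h3 (by omega) (by omega)
    exact hx k (by omega) h5
  rw [← this, Int.card_Ico] at h2
  have h3 : ((∑ t ∈ Finset.Ico j (x + 1), opSize n Op t : ℕ) : ℤ) ≤ x - j := by omega
  push_cast at h3
  omega

/-- The opener relation is determined by its size function. -/
lemma IsOp.opOf_eq {n : ℕ} {Op : ℤ → ℤ → Prop} (h : IsOp n Op) (i x : ℤ) :
    opOf (opSize n Op) i x ↔ Op i x := by
  constructor
  · rintro ⟨h1, h2, h3⟩
    by_contra hc
    by_cases hz : ∃ k, Op k x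
    · obtain ⟨k, hk⟩ := hz
      have hkx := h.le _ _ hk
      rcases lt_trichotomy k i with hki | rfl | hki
      · have := h.hgt_lt (j := i) h1 (fun t ht ht' => by
          have := h.uniq _ _ _ hk ht'; omega)
        omega
      · exact hc hk
      · have := h.hgt_ge hk
        have := h3 k hki hkx
        omega
    · push Not at hz
      have := h.hgt_lt (j := i) h1 (fun t _ => hz t)
      omega
  · intro hx
    refine ⟨h.le _ _ hx, h.hgt_ge hx, fun j h1 h2 => h.hgt_lt h2 (fun t ht ht' => ?_)⟩
    have := h.uniq _ _ _ hx ht'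
    omega

/-! ### From size functions to opener relations -/

lemma opOf_exists (f : ℤ → ℕ) (i x : ℤ) (hi : i ≤ x) (hh : hgt f i ≤ hgt f (x + 1)) :
    ∃ j, i ≤ j ∧ opOf f j x := by
  classical
  let S := (Finset.Icc i x).filter (fun j => hgt f j ≤ hgt f (x + 1))
  have hS : S.Nonempty := ⟨i, by simp [S]; omega⟩
  have hm := S.max'_mem hS
  set k := S.max' hS with hk
  simp only [S, Finset.mem_filter, Finset.mem_Icc] at hm
  refine ⟨k, hm.1.1, hm.1.2, hm.2, fun j h1 h2 => ?_⟩
  by_contra hc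
  have : j ∈ S := by
    simp only [S, Finset.mem_filter, Finset.mem_Icc]
    omega
  have := S.le_max' j this
  omega

lemma opOf_isOp (n : ℕ) (hn : 1 ≤ n) (f : ℤ → ℕ) (hf : ∀ t, f (t + n) = f t)
    (hs : hgt f n ≤ 0) : IsOp n (opOf f) where
  le i x h := h.1
  lt i x h := by
    by_contra hc
    obtain ⟨h1, h2, h3⟩ := h
    have hp := hgt_per n f hf i
    have := h3 (i + n) (by omega) (by omega)
    omega
  uniq i j x hi hj := by
    obtain ⟨h1, h2, h3⟩ := hi
    obtain ⟨h4, h5, h6⟩ := hj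
    rcases lt_trichotomy i j with h | h | h
    · have := h3 j h h4; omega
    · exact h
    · have := h6 i h h1; omega
  nest i x y h hi hy := by
    obtain ⟨h1, h2, h3⟩ := h
    apply opOf_exists f i y hi
    rcases eq_or_lt_of_le hy with rfl | hy
    · exact h2
    · have := h3 (y + 1) (by omega) (by omega)
      omega
  per i x := by
    unfold opOf
    have e : x + n + 1 = (x + 1) + n := by ring
    rw [e, hgt_per n f hf, hgt_per n f hf]
    constructor
    · rintro ⟨h1, h2, h3⟩
      refine ⟨by omega, by omega, fun j hj hj' => ?_⟩
      have := h3 (j + n) (by omega) (by omega)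
      rw [hgt_per n f hf] at this
      omega
    · rintro ⟨h1, h2, h3⟩
      refine ⟨by omega, by omega, fun j hj hj' => ?_⟩
      have := h3 (j - n) (by omega) (by omega)
      have h4 := hgt_per n f hf (j - n)
      rw [sub_add_cancel] at h4
      omega

lemma opSize_opOf (n : ℕ) (f : ℤ → ℕ) (hf : ∀ t, f (t + n) = f t) (hn : 1 ≤ n)
    (hs : hgt f n ≤ 0) (i : ℤ) : opSize n (opOf f) i = f i := by
  classical
  have hO := opOf_isOp n hn f hf hs
  have : (Finset.Ico (hgt f i) (hgt f i + f i)).card = f i := by simp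
  conv_rhs => rw [← this]
  unfold opSize
  apply Finset.card_bij (fun y _ => hgt f (y + 1))
  · intro x hx
    simp only [Finset.mem_filter, Finset.mem_Ico] at hx ⊢
    obtain ⟨_, h1, h2, h3⟩ := hx
    refine ⟨h2, ?_⟩
    have hs := hgt_succ f i
    rcases eq_or_lt_of_le h1 with rfl | h1
    · omega
    · have := h3 (i + 1) (by omega) (by omega)
      omega
  · intro x hx y hy e
    simp only [Finset.mem_filter, Finset.mem_Ico] at hx hy e
    obtain ⟨_, h1, h2, h3⟩ := hx
    obtain ⟨_, h4, h5, h6⟩ := hy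
    rcases lt_trichotomy x y with h | h | h
    · have := h6 (x + 1) (by omega) (by omega); omega
    · exact h
    · have := h3 (y + 1) (by omega) (by omega); omega
  · intro l hl
    simp only [Finset.mem_Ico] at hl
    let S := (Finset.Ico i (i + n)).filter (fun x => hgt f (x + 1) ≤ l)
    have hS : S.Nonempty := by
      refine ⟨i + n - 1, ?_⟩
      simp only [S, Finset.mem_filter, Finset.mem_Ico]
      have := hgt_per n f hf i
      rw [sub_add_cancel]
      omega
    have hm := S.min'_mem hS
    set x := S.min' hS with hx
    simp only [S, Finset.mem_filter, Finset.mem_Ico] at hm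
    have hmin : ∀ y, i ≤ y → y < x → l < hgt f (y + 1) := by
      intro y h1 h2
      by_contra hc
      have : y ∈ S := by
        simp only [S, Finset.mem_filter, Finset.mem_Ico]
        omega
      have := S.min'_le y this
      omega
    have heq : hgt f (x + 1) = l := by
      have h1 := hgt_succ f x
      rcases eq_or_lt_of_le hm.1.1 with h | h
      · rw [← h] at h1 hm ⊢; omega
      · have h2 := hmin (x - 1) (by omega) (by omega)
        rw [sub_add_cancel] at h2
        omega
    refine ⟨x, ?_, heq⟩
    simp only [Finset.mem_filter, Finset.mem_Ico]
    refine ⟨hm.1, hm.1.1, by omega, fun j h1 h2 => ?_⟩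
    have := hmin (j - 1) (by omega) (by omega)
    rw [sub_add_cancel] at this
    omega

/-! ### Lifted equivalence relations -/

/-- Properties of the lift to the integers of a type B non-crossing partition. -/
structure GoodR (n : ℕ) (R : ℤ → ℤ → Prop) : Prop where
  refl : ∀ x, R x x
  symm : ∀ x y, R x y → R y x
  trans : ∀ x y z, R x y → R y z → R x z
  per2 : ∀ x k, R x (x + 2 * n * k)
  per : ∀ x y, R x y → R (x + n) (y + n)
  nc : ∀ a b c d : ℤ, a < b → b < c → c < d → d < a + 2 * n → R a c → R b d → R a b
  zero : ∀ x y, R x (x + n) → R y (y + n) → R x y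

/-- Opener relation of a lifted equivalence relation. -/
def opR (n : ℕ) (R : ℤ → ℤ → Prop) (i x : ℤ) : Prop :=
  i ≤ x ∧ x < i + n ∧ R i x ∧ ¬ R x (x + n) ∧ ∀ y, i - n < y → y < i → ¬ R y i

/-- Equivalence relation of an opener relation. -/
def relOf (n : ℕ) (Op : ℤ → ℤ → Prop) (x y : ℤ) : Prop :=
  (∃ i k, Op i x ∧ Op (i + 2 * n * k) y) ∨ ((∀ i, ¬ Op i x) ∧ ∀ i, ¬ Op i y)

lemma GoodR.add_iff {n : ℕ} {R : ℤ → ℤ → Prop} (h : GoodR n R) (x y : ℤ) :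
    R (x + n) (y + n) ↔ R x y := by
  refine ⟨fun hr => ?_, h.per x y⟩
  have h1 := h.per _ _ hr
  have h2 := h.per2 x 1
  have h3 := h.per2 y 1
  have e1 : x + n + n = x + 2 * n * 1 := by ring
  have e2 : y + n + n = y + 2 * n * 1 := by ring
  rw [e1, e2] at h1
  exact h.trans _ _ _ h2 (h.trans _ _ _ h1 (h.symm _ _ h3))

lemma GoodR.zero_congr {n : ℕ} {R : ℤ → ℤ → Prop} (h : GoodR n R) {x y : ℤ} (hxy : R x y)
    (hz : R x (x + n)) : R y (y + n) :=
  h.trans _ _ _ (h.symm _ _ hxy) (h.trans _ _ _ hz (h.per _ _ hxy))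

/-- Shift by `2n`. -/
lemma GoodR.shift {n : ℕ} {R : ℤ → ℤ → Prop} (h : GoodR n R) (x y k l : ℤ) :
    R (x + 2 * n * k) (y + 2 * n * l) ↔ R x y :=
  ⟨fun hr => h.trans _ _ _ (h.per2 x k) (h.trans _ _ _ hr (h.symm _ _ (h.per2 y l))),
   fun hr => h.trans _ _ _ (h.symm _ _ (h.per2 x k)) (h.trans _ _ _ hr (h.per2 y l))⟩

/-- A nonzero block is contained in an arc. -/
lemma GoodR.arc {n : ℕ} {R : ℤ → ℤ → Prop} (h : GoodR n R) {z x y : ℤ}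
    (hz : ¬ R x (x + n)) (h1 : z < x) (h2 : x < z + n) (h3 : x < y) (h4 : y < x + n)
    (hzx : R z x) (hxy : R x y) : y < z + n := by
  by_contra hc
  rcases eq_or_lt_of_le (not_lt.1 hc) with h5 | h5
  · subst h5
    exact hz (h.zero_congr hzx (h.trans _ _ _ hzx hxy))
  · have hzy := h.trans _ _ _ hzx hxy
    have h6 : R (y - n) (z + n) := by
      rw [← h.add_iff]
      have e1 : y - n + n = y + 2 * n * 0 := by ring
      have e2 : z + n + n = z + 2 * n * 1 := by ring
      rw [e1, e2, h.shift]
      exact h.symm _ _ hzy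
    have h7 := h.nc z (y - n) x (z + n) (by omega) (by omega) (by omega) (by omega) hzx h6
    exact hz (h.zero_congr hzx (h.trans _ _ _ h7 h6))

lemma opR_exists {n : ℕ} (hn : 1 ≤ n) {R : ℤ → ℤ → Prop} (h : GoodR n R) {x : ℤ}
    (hx : ¬ R x (x + n)) : ∃ i, opR n R i x := by
  classical
  let S := (Finset.Ioc (x - n) x).filter (fun j => R j x)
  have hS : S.Nonempty := ⟨x, by
    simp only [S, Finset.mem_filter, Finset.mem_Ioc]
    exact ⟨by omega, h.refl x⟩⟩
  have hm := S.min'_mem hS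
  set k := S.min' hS with hk
  simp only [S, Finset.mem_filter, Finset.mem_Ioc] at hm
  refine ⟨k, hm.1.2, by omega, hm.2, hx, fun y h1 h2 hy => ?_⟩
  have hyx := h.trans _ _ _ hy hm.2
  by_cases hc : x - n < y
  · have : y ∈ S := by
      simp only [S, Finset.mem_filter, Finset.mem_Ioc]
      exact ⟨by omega, hyx⟩
    have := S.min'_le y this
    omega
  · have hkz : ¬ R k (k + n) := fun hh => hx (h.zero_congr hm.2 hh)
    rcases eq_or_lt_of_le hm.1.2 with h5 | h5
    · omega
    · have := h.arc hkz h2 (by omega) h5 (by omega) hy hm.2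
      omega

lemma opR_refl {n : ℕ} (hn : 1 ≤ n) {R : ℤ → ℤ → Prop} (h : GoodR n R) {i x : ℤ}
    (hx : opR n R i x) : opR n R i i := by
  obtain ⟨h1, h2, h3, h4, h5⟩ := hx
  exact ⟨le_rfl, by omega, h.refl i, fun hh => h4 (h.zero_congr h3 hh), h5⟩

lemma opR_uniq {n : ℕ} {R : ℤ → ℤ → Prop} (h : GoodR n R) {i j x : ℤ}
    (hi : opR n R i x) (hj : opR n R j x) : i = j := by
  obtain ⟨h1, h2, h3, h4, h5⟩ := hi
  obtain ⟨g1, g2, g3, g4, g5⟩ := hj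
  rcases lt_trichotomy i j with hh | hh | hh
  · exact absurd (h.trans _ _ _ h3 (h.symm _ _ g3)) (g5 i (by omega) hh)
  · exact hh
  · exact absurd (h.trans _ _ _ g3 (h.symm _ _ h3)) (h5 j (by omega) hh)

lemma opR_isOp {n : ℕ} (hn : 1 ≤ n) {R : ℤ → ℤ → Prop} (h : GoodR n R) :
    IsOp n (opR n R) where
  le i x hx := hx.1
  lt i x hx := hx.2.1
  uniq i j x hi hj := opR_uniq h hi hj
  nest i x y hx hiy hyx := by
    have hx' := hx
    obtain ⟨h1, h2, h3, h4, h5⟩ := hx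
    by_cases hyR : R y x
    · refine ⟨i, le_rfl, hiy, by omega, h.trans _ _ _ h3 (h.symm _ _ hyR),
        fun hh => h4 (h.zero_congr hyR hh), h5⟩
    · have hne : y ≠ x := fun e => hyR (e ▸ h.refl x)
      have hne' : i ≠ y := fun e => hyR (e ▸ h3)
      have hyz : ¬ R y (y + n) := fun hz => by
        have := h.nc i y x (y + n) (by omega) (by omega) (by omega) (by omega) h3 hz
        exact hyR (h.trans _ _ _ (h.symm _ _ this) h3)
      obtain ⟨j, hj⟩ := opR_exists hn h hyz
      refine ⟨j, ?_, hj⟩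
      by_contra hc
      obtain ⟨g1, g2, g3, g4, g5⟩ := hj
      have := h.nc j i y x (by omega) (by omega) (by omega) (by omega) g3 h3
      exact hyR (h.trans _ _ _ (h.symm _ _ g3) (h.trans _ _ _ this h3))
  per i x := by
    unfold opR
    rw [h.add_iff, h.add_iff]
    constructor
    · rintro ⟨h1, h2, h3, h4, h5⟩
      refine ⟨by omega, by omega, h3, h4, fun y hy hy' hR => ?_⟩
      exact h5 (y + n) (by omega) (by omega) (h.per _ _ hR)
    · rintro ⟨h1, h2, h3, h4, h5⟩
      refine ⟨by omega, by omega, h3, h4, fun y hy hy' hR => ?_⟩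
      refine h5 (y - n) (by omega) (by omega) ?_
      rw [← h.add_iff, sub_add_cancel]
      exact hR

lemma opR_none {n : ℕ} (hn : 1 ≤ n) {R : ℤ → ℤ → Prop} (h : GoodR n R) {x : ℤ} :
    (∀ i, ¬ opR n R i x) ↔ R x (x + n) := by
  constructor
  · intro hh
    by_contra hc
    obtain ⟨i, hi⟩ := opR_exists hn h hc
    exact hh i hi
  · intro hh i hi
    exact hi.2.2.2.1 hh

lemma relOf_opR {n : ℕ} (hn : 1 ≤ n) {R : ℤ → ℤ → Prop} (h : GoodR n R) (x y : ℤ) :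
    relOf n (opR n R) x y ↔ R x y := by
  unfold relOf
  rw [opR_none hn h, opR_none hn h]
  constructor
  · rintro (⟨i, k, h1, h2⟩ | ⟨h1, h2⟩)
    · have h3 := h2.2.2.1
      exact h.trans _ _ _ (h.symm _ _ h1.2.2.1) (h.trans _ _ _ (h.per2 i k) h3)
    · exact h.zero x y h1 h2
  · intro hxy
    by_cases hz : R x (x + n)
    · exact Or.inr ⟨hz, h.zero_congr hxy hz⟩
    · left
      have hz' : ¬ R y (y + n) := fun hh => hz (h.zero_congr (h.symm _ _ hxy) hh)
      obtain ⟨i, hi⟩ := opR_exists hn h hz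
      obtain ⟨j, hj⟩ := opR_exists hn h hz'
      have hij : R i j :=
        h.trans _ _ _ hi.2.2.1 (h.trans _ _ _ hxy (h.symm _ _ hj.2.2.1))
      set k := (j - i) / (2 * n) with hk
      refine ⟨i, k, hi, ?_⟩
      have e := Int.emod_add_mul_ediv (j - i) (2 * n)
      have l1 := Int.emod_nonneg (j - i) (show (2 * n : ℤ) ≠ 0 by omega)
      have l2 := Int.emod_lt_of_pos (j - i) (show (2 * n : ℤ) > 0 by omega)
      rw [← hk] at e
      set d := (j - i) % (2 * n) with hd
      have hj2 : j = i + d + 2 * n * k := by linarith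
      have hid : R i (i + d) := by
        have : R (i + 2 * n * 0) (i + d + 2 * n * k) := by
          rw [← hj2]; simpa using hij
        rwa [h.shift] at this
      rcases eq_or_lt_of_le l1 with hd0 | hd0
      · have : j = i + 2 * n * k := by rw [hj2, ← hd0]; ring
        rw [← this]; exact hj
      · exfalso
        rcases lt_trichotomy d n with hdn | hdn | hdn
        · refine hj.2.2.2.2 (i + 2 * n * k) (by omega) (by omega) ?_
          rw [hj2, h.shift]; exact hid
        · rw [hdn] at hid
          exact (opR_refl hn h hi).2.2.2.1 hid
        · refine hi.2.2.2.2 (i + d + 2 * n * (-1)) (by linarith) (by linarith) ?_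
          have := h.shift (i + d) i (-1) 0
          simp only [mul_zero, add_zero] at this
          rw [this]
          exact h.symm _ _ hid

lemma IsOp.perk {n : ℕ} {Op : ℤ → ℤ → Prop} (h : IsOp n Op) (i x k : ℤ) :
    Op (i + n * k) (x + n * k) ↔ Op i x := by
  induction k with
  | zero => simp
  | succ k ih =>
    rw [← ih, ← h.per (i + n * k)]
    have e1 : i + n * ((k:ℤ) + 1) = i + n * k + n := by ring
    have e2 : x + n * ((k:ℤ) + 1) = x + n * k + n := by ring
    rw [e1, e2]
  | pred k ih =>
    rw [← ih, ← h.per (i + n * (-k - 1))]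
    have e1 : i + n * (-(k:ℤ) - 1) + n = i + n * (-k) := by ring
    have e2 : x + n * (-(k:ℤ) - 1) + n = x + n * (-k) := by ring
    rw [e1, e2]

lemma IsOp.per2k {n : ℕ} {Op : ℤ → ℤ → Prop} (h : IsOp n Op) (i x k : ℤ) :
    Op (i + 2 * n * k) (x + 2 * n * k) ↔ Op i x := by
  have := h.perk i x (2 * k)
  have e : (n : ℤ) * (2 * k) = 2 * n * k := by ring
  rwa [e] at this

/-- `2nk` within window constraints. -/
lemma window {n : ℕ} {k : ℤ} (h1 : -(2 * n : ℤ) < 2 * n * k) (h2 : 2 * n * k < 4 * n) :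
    k = 0 ∨ k = 1 := by
  have hn : (0:ℤ) < 2 * n := by nlinarith
  have : -1 < k := by nlinarith
  have : k < 2 := by nlinarith
  omega

lemma relOf_good {n : ℕ} (hn : 1 ≤ n) {Op : ℤ → ℤ → Prop} (h : IsOp n Op) :
    GoodR n (relOf n Op) where
  refl x := by
    by_cases hx : ∃ i, Op i x
    · obtain ⟨i, hi⟩ := hx
      exact Or.inl ⟨i, 0, hi, by simpa using hi⟩
    · push Not at hx
      exact Or.inr ⟨hx, hx⟩
  symm x y hxy := by
    rcases hxy with ⟨i, k, h1, h2⟩ | ⟨h1, h2⟩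
    · refine Or.inl ⟨_, -k, h2, ?_⟩
      have : i + 2 * n * k + 2 * n * (-k) = i := by ring
      rwa [this]
    · exact Or.inr ⟨h2, h1⟩
  trans x y z hxy hyz := by
    rcases hxy with ⟨i, k, h1, h2⟩ | ⟨h1, h2⟩
    · rcases hyz with ⟨j, l, h3, h4⟩ | ⟨h3, h4⟩
      · have := h.uniq _ _ _ h2 h3
        refine Or.inl ⟨i, k + l, h1, ?_⟩
        have e : i + 2 * n * (k + l) = j + 2 * n * l := by rw [← this]; ring
        rwa [e]
      · exact absurd h2 (h3 _)
    · rcases hyz with ⟨j, l, h3, h4⟩ | ⟨h3, h4⟩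
      · exact absurd h3 (h2 _)
      · exact Or.inr ⟨h1, h4⟩
  per2 x k := by
    by_cases hx : ∃ i, Op i x
    · obtain ⟨i, hi⟩ := hx
      exact Or.inl ⟨i, k, hi, (h.per2k _ _ _).2 hi⟩
    · push Not at hx
      refine Or.inr ⟨hx, fun i hi => ?_⟩
      have := (h.per2k (i - 2 * n * k) x k).1
      rw [sub_add_cancel] at this
      exact hx _ (this hi)
  per x y hxy := by
    rcases hxy with ⟨i, k, h1, h2⟩ | ⟨h1, h2⟩
    · refine Or.inl ⟨i + n, k, (h.per _ _).2 h1, ?_⟩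
      have e : i + n + 2 * n * k = i + 2 * n * k + n := by ring
      rw [e, h.per]; exact h2
    · refine Or.inr ⟨fun i hi => h1 (i - n) ?_, fun i hi => h2 (i - n) ?_⟩
      · rw [← h.per, sub_add_cancel]; exact hi
      · rw [← h.per, sub_add_cancel]; exact hi
  nc a b c d hab hbc hcd hda hac hbd := by
    -- auxiliary: shift down by `2n`
    have down : ∀ i x, Op (i + 2 * n) x → Op i (x - 2 * n) := by
      intro i x hi
      have := (h.per2k i (x - 2 * n) 1).1
      simp only [mul_one, sub_add_cancel] at this
      exact this hi
    have key : ∀ i k x y, Op i x → Op (i + 2 * n * k) y → x < y → y < x + 2 * n →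
        Op i y ∨ Op i (y - 2 * n) := by
      intro i k x y h1 h2 h3 h4
      have a1 := h.le _ _ h1
      have a2 := h.lt _ _ h1
      have a3 := h.le _ _ h2
      have a4 := h.lt _ _ h2
      rcases window (n := n) (k := k) (by linarith) (by linarith) with rfl | rfl
      · left; simpa using h2
      · right; apply down; simpa using h2
    have fin0 : ∀ i, Op i a → Op i b → relOf n Op a b := fun i h1 h2 =>
      Or.inl ⟨i, 0, h1, by simpa using h2⟩
    rcases hbd with ⟨j, l, hb, hd⟩ | ⟨hb, hd⟩
    · have hb1 := h.le _ _ hb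
      have hd' := key j l b d hb hd (by omega) (by omega)
      rcases hac with ⟨i, k, ha, hc⟩ | ⟨ha, hc⟩
      · have ha1 := h.le _ _ ha
        have hc' := key i k a c ha hc (by omega) (by omega)
        rcases hd' with hd' | hd'
        · obtain ⟨p, hp1, hp2⟩ := h.nest j d c hd' (by omega) (by omega)
          rcases hc' with hc' | hc'
          · obtain ⟨q, hq1, hq2⟩ := h.nest i c b hc' (by omega) (by omega)
            have e1 := h.uniq _ _ _ hp2 hc'
            have e2 := h.uniq _ _ _ hq2 hb
            have : i = j := by omega
            subst this
            exact fin0 _ ha hb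
          · obtain ⟨q, hq1, hq2⟩ := h.nest i a (d - 2 * n) ha
              (by have := h.le _ _ hc'; omega) (by omega)
            have e3 := (h.per2k q (d - 2 * n) 1).2 hq2
            simp only [mul_one, sub_add_cancel] at e3
            have e1 := h.uniq _ _ _ e3 hd'
            have e4 := (h.per2k i (c - 2 * n) 1).2 hc'
            simp only [mul_one, sub_add_cancel] at e4
            have e2 := h.uniq _ _ _ e4 hp2
            have : j = i + 2 * n * 1 := by omega
            exact Or.inl ⟨i, 1, ha, this ▸ hb⟩
        · have := h.le _ _ hd'
          obtain ⟨p, hp1, hp2⟩ := h.nest j b a hb (by omega) (by omega)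
          have e1 := h.uniq _ _ _ hp2 ha
          rcases hc' with hc' | hc'
          · obtain ⟨q, hq1, hq2⟩ := h.nest i c b hc' (by omega) (by omega)
            have e2 := h.uniq _ _ _ hq2 hb
            have : i = j := by omega
            subst this
            exact fin0 _ ha hb
          · obtain ⟨q, hq1, hq2⟩ := h.nest i a (d - 2 * n) ha
              (by have := h.le _ _ hc'; omega) (by omega)
            have e2 := h.uniq _ _ _ hq2 hd'
            have : i = j := by omega
            subst this
            exact fin0 _ ha hb
      · exfalso
        rcases hd' with hd' | hd'
        · obtain ⟨p, _, hp⟩ := h.nest j d c hd' (by omega) (by omega)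
          exact hc _ hp
        · have := h.le _ _ hd'
          obtain ⟨p, _, hp⟩ := h.nest j b a hb (by omega) (by omega)
          exact ha _ hp
    · rcases hac with ⟨i, k, ha, hc⟩ | ⟨ha, hc⟩
      · exfalso
        have ha1 := h.le _ _ ha
        have hc' := key i k a c ha hc (by omega) (by omega)
        rcases hc' with hc' | hc'
        · obtain ⟨p, _, hp⟩ := h.nest i c b hc' (by omega) (by omega)
          exact hb _ hp
        · obtain ⟨q, hq1, hq2⟩ := h.nest i a (d - 2 * n) ha
              (by have := h.le _ _ hc'; omega) (by omega)
          have e3 := (h.per2k q (d - 2 * n) 1).2 hq2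
          simp only [mul_one, sub_add_cancel] at e3
          exact hd _ e3
      · exact Or.inr ⟨ha, hb⟩
  zero x y hx hy := by
    have key : ∀ z, relOf n Op z (z + n) → ∀ i, ¬ Op i z := by
      intro z hz i hi
      rcases hz with ⟨j, k, h1, h2⟩ | ⟨h1, h2⟩
      · have e1 := h.uniq _ _ _ hi h1
        have e2 := h.uniq _ _ _ ((h.per _ _).2 h1) h2
        have e3 : (n : ℤ) * (2 * k - 1) = 0 := by linarith
        rcases mul_eq_zero.1 e3 with e | e <;> omega
      · exact h1 _ hi
    exact Or.inr ⟨key x hx, key y hy⟩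

lemma opR_relOf {n : ℕ} (hn : 1 ≤ n) {Op : ℤ → ℤ → Prop} (h : IsOp n Op) (i x : ℤ) :
    opR n (relOf n Op) i x ↔ Op i x := by
  have hG := relOf_good hn h
  have key : ∀ i, Op i x → opR n (relOf n Op) i x := by
    intro i hi
    refine ⟨h.le _ _ hi, h.lt _ _ hi, Or.inl ⟨i, 0, h.refl hi, by simpa using hi⟩, ?_, ?_⟩
    · rintro (⟨j, k, h1, h2⟩ | ⟨h1, h2⟩)
      · have e2 := h.uniq _ _ _ ((h.per _ _).2 h1) h2
        have e3 : (n : ℤ) * (2 * k - 1) = 0 := by linarith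
        rcases mul_eq_zero.1 e3 with e | e <;> omega
      · exact h1 _ hi
    · rintro y hy hy' (⟨j, k, h1, h2⟩ | ⟨h1, h2⟩)
      · have e1 := h.uniq _ _ _ h2 (h.refl hi)
        have l1 := h.le _ _ h1
        have l2 := h.lt _ _ h1
        rcases window (n := n) (k := k) (by linarith) (by linarith) with rfl | rfl
        · omega
        · omega
      · exact h2 _ (h.refl hi)
  refine ⟨fun hi => ?_, key i⟩
  have : ∃ j, Op j x := by
    by_contra hc
    push Not at hc
    refine hi.2.2.2.1 (Or.inr ⟨hc, fun j hj => hc (j - n) ?_⟩)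
    rw [← h.per, sub_add_cancel]; exact hj
  obtain ⟨j, hj⟩ := this
  have := opR_uniq hG hi (key j hj)
  rwa [this]

/-! ### Lifting partitions -/

/-- Reduction of an integer modulo `2n`. -/
def cst (n : ℕ) (hn : 1 ≤ n) (x : ℤ) : Fin (2 * n) :=
  ⟨(x % (2 * n : ℤ)).toNat, by
    have l1 := Int.emod_nonneg x (show (2 * n : ℤ) ≠ 0 by omega)
    have l2 := Int.emod_lt_of_pos x (show (2 * n : ℤ) > 0 by omega)
    omega⟩

lemma cst_val (n : ℕ) (hn : 1 ≤ n) (x : ℤ) :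
    (((cst n hn x).val : ℕ) : ℤ) = x % (2 * n : ℤ) := by
  have l1 := Int.emod_nonneg x (show (2 * n : ℤ) ≠ 0 by omega)
  simp only [cst]
  omega

lemma cst_shift (n : ℕ) (hn : 1 ≤ n) (x k : ℤ) : cst n hn (x + 2 * n * k) = cst n hn x := by
  apply Fin.ext
  have h1 := cst_val n hn (x + 2 * n * k)
  have h2 := cst_val n hn x
  rw [Int.add_mul_emod_self_left] at h1
  omega

lemma cst_nat (n : ℕ) (hn : 1 ≤ n) (v : Fin (2 * n)) : cst n hn (v.val : ℤ) = v := by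
  apply Fin.ext
  have h1 := cst_val n hn v.val
  have := v.isLt
  rw [Int.emod_eq_of_lt (by omega) (by omega)] at h1
  omega

/-- Representative of an integer modulo `2n`. -/
lemma cst_decomp (n : ℕ) (hn : 1 ≤ n) (x : ℤ) :
    ∃ k : ℤ, x = ((cst n hn x).val : ℤ) + 2 * n * k := by
  refine ⟨x / (2 * n), ?_⟩
  rw [cst_val]
  exact (Int.emod_add_mul_ediv x (2 * n)).symm

lemma cst_inj (n : ℕ) (hn : 1 ≤ n) (x y : ℤ) (h : cst n hn x = cst n hn y) (h1 : x - y < 2 * n)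
    (h2 : y - x < 2 * n) : x = y := by
  obtain ⟨k, hk⟩ := cst_decomp n hn x
  obtain ⟨l, hl⟩ := cst_decomp n hn y
  rw [h] at hk
  have e : x - y = 2 * n * (k - l) := by linarith
  have hn' : (0:ℤ) < 2 * n := by omega
  have a1 : k - l < 1 := by nlinarith
  have a2 : -1 < k - l := by nlinarith
  have : k = l := by omega
  rw [this] at hk
  omega

lemma negB_cst (n : ℕ) (hn : 1 ≤ n) (x : ℤ) : negB (cst n hn x) = cst n hn (x + n) := by
  apply Fin.ext
  have h1 := cst_val n hn (x + n)
  have h2 := cst_val n hn x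
  zify
  rw [h1]
  simp only [negB]
  push_cast
  rw [h2, Int.emod_add_emod]

/-- The lifted equivalence relation of a partition. -/
def rel (n : ℕ) (hn : 1 ≤ n) (π : Finpartition (Finset.univ : Finset (Fin (2 * n))))
    (x y : ℤ) : Prop :=
  π.part (cst n hn x) = π.part (cst n hn y)

lemma mem_NCB {n : ℕ} {π : Finpartition (Finset.univ : Finset (Fin (2 * n)))} :
    π ∈ NCB n ↔ IsNoncrossing π ∧ (∀ B ∈ π.parts, negBlock B ∈ π.parts) ∧
    (π.parts.filter (fun B => negBlock B = B)).card ≤ 1 := by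
  simp [NCB, fil]

lemma negBlock_part {n : ℕ} (hn : 1 ≤ n) {π : Finpartition (Finset.univ : Finset (Fin (2 * n)))}
    (h : ∀ B ∈ π.parts, negBlock B ∈ π.parts) (x : ℤ) :
    negBlock (π.part (cst n hn x)) = π.part (cst n hn (x + n)) := by
  symm
  apply π.part_eq_of_mem
  · exact h _ (by simp)
  · rw [← negB_cst]
    exact Finset.mem_image_of_mem _ (by simp)

lemma parts_eq_part {n : ℕ} (hn : 1 ≤ n)
    {π : Finpartition (Finset.univ : Finset (Fin (2 * n)))} {B : Finset (Fin (2 * n))}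
    (hB : B ∈ π.parts) : ∃ x : ℤ, B = π.part (cst n hn x) := by
  obtain ⟨v, hv⟩ := π.nonempty_of_mem_parts hB
  exact ⟨v.val, by rw [cst_nat]; exact (π.part_eq_of_mem hB hv).symm⟩

lemma rel_good {n : ℕ} (hn : 1 ≤ n) {π : Finpartition (Finset.univ : Finset (Fin (2 * n)))}
    (h : π ∈ NCB n) : GoodR n (rel n hn π) := by
  obtain ⟨hnc, hneg, hz⟩ := mem_NCB.1 h
  have sh : ∀ x k, rel n hn π x (x + 2 * n * k) := fun x k => by
    unfold rel; rw [cst_shift]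
  have base : ∀ a b c d : ℤ, 0 ≤ a → a < b → b < c → c < d → d < 2 * n →
      rel n hn π a c → rel n hn π b d → rel n hn π a b := by
    intro a b c d h0 h1 h2 h3 h4 hac hbd
    have va := cst_val n hn a
    have vb := cst_val n hn b
    have vc := cst_val n hn c
    have vd := cst_val n hn d
    rw [Int.emod_eq_of_lt (by omega) (by omega)] at va vb vc vd
    apply hnc (cst n hn a) (cst n hn b) (cst n hn c) (cst n hn d) <;>
      try (rw [Fin.lt_def]; omega)
    · simp
    · simp
    · simp
    · rw [hac]; simp
    · simp
    · rw [hbd]; simp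
  have sh' : ∀ x, rel n hn π x (x - 2 * n) := fun x => by
    have := sh x (-1)
    have e : x + 2 * n * (-1) = x - 2 * n := by ring
    rwa [e] at this
  have base2 : ∀ a b c d : ℤ, 0 ≤ a → a < 2 * n → a < b → b < c → c < d → d < a + 2 * n →
      rel n hn π a c → rel n hn π b d → rel n hn π a b := by
    intro a b c d h0 h0' h1 h2 h3 h4 hac hbd
    have sb := sh' b
    have sc := sh' c
    have sd := sh' d
    by_cases hd : d < 2 * n
    · exact base a b c d h0 h1 h2 h3 hd hac hbd
    by_cases hc : c < 2 * n
    · have := base (d - 2 * n) a b c (by omega) (by omega) h1 h2 hc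
        (sd.symm.trans hbd.symm) hac
      exact this.symm.trans (sd.symm.trans hbd.symm)
    by_cases hb : b < 2 * n
    · have := base (c - 2 * n) (d - 2 * n) a b (by omega) (by omega) (by omega) h1 hb
        (sc.symm.trans hac.symm) (sd.symm.trans hbd.symm)
      exact hac.trans (sc.trans (this.trans (sd.symm.trans hbd.symm)))
    · have := base (b - 2 * n) (c - 2 * n) (d - 2 * n) a (by omega) (by omega) (by omega)
        (by omega) (by omega) (sb.symm.trans (hbd.trans sd)) (sc.symm.trans hac.symm)
      exact hac.trans (sc.trans (this.symm.trans sb.symm))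
  refine ⟨fun x => rfl, fun x y h => h.symm, fun x y z h1 h2 => h1.trans h2, sh, ?_, ?_, ?_⟩
  · intro x y hxy
    unfold rel at *
    rw [← negBlock_part hn hneg, ← negBlock_part hn hneg, hxy]
  · intro a b c d h1 h2 h3 h4 hac hbd
    obtain ⟨k, hk⟩ := cst_decomp n hn a
    have hlt := (cst n hn a).isLt
    have s : ∀ x, rel n hn π x (x - 2 * n * k) := fun x => by
      have := sh x (-k)
      have e : x + 2 * n * (-k) = x - 2 * n * k := by ring
      rwa [e] at this
    have := base2 (a - 2 * n * k) (b - 2 * n * k) (c - 2 * n * k) (d - 2 * n * k)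
      (by omega) (by omega) (by omega) (by omega) (by omega) (by omega)
      ((s a).symm.trans (hac.trans (s c))) ((s b).symm.trans (hbd.trans (s d)))
    exact (s a).trans (this.trans (s b).symm)
  · intro x y hx hy
    unfold rel at *
    rw [← negBlock_part hn hneg] at hx hy
    exact Finset.card_le_one.1 hz _ (by simp [hx.symm]) _ (by simp [hy.symm])

/-- Partitions are determined by their lifts. -/
lemma rel_inj {n : ℕ} (hn : 1 ≤ n) {π σ : Finpartition (Finset.univ : Finset (Fin (2 * n)))}
    (h : ∀ x y, rel n hn π x y ↔ rel n hn σ x y) : π = σ := by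
  have hp : ∀ v, π.part v = σ.part v := by
    intro v
    ext w
    rw [π.mem_part_iff_part_eq_part (by simp) (by simp),
      σ.mem_part_iff_part_eq_part (by simp) (by simp)]
    have := h w.val v.val
    unfold rel at this
    rwa [cst_nat, cst_nat] at this
  ext B
  constructor
  · intro hB
    obtain ⟨x, rfl⟩ := parts_eq_part hn hB
    rw [hp]; simp
  · intro hB
    obtain ⟨x, rfl⟩ := parts_eq_part hn hB
    rw [← hp]; simp

/-- Every good relation comes from a partition. -/
lemma rel_surj {n : ℕ} (hn : 1 ≤ n) {R : ℤ → ℤ → Prop} (h : GoodR n R) :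
    ∃ π ∈ NCB n, ∀ x y, rel n hn π x y ↔ R x y := by
  classical
  let S : Setoid (Fin (2 * n)) :=
    ⟨fun u v => R u.val v.val, fun u => h.refl _, fun {u v} => h.symm _ _,
      fun {u v w} => h.trans _ _ _⟩
  let π := Finpartition.ofSetoid S
  have hrel : ∀ x y, rel n hn π x y ↔ R x y := by
    intro x y
    unfold rel
    rw [← π.mem_part_iff_part_eq_part (by simp) (by simp)]
    rw [Finpartition.mem_part_ofSetoid_iff_rel]
    change R _ _ ↔ _
    obtain ⟨k, hk⟩ := cst_decomp n hn x
    obtain ⟨l, hl⟩ := cst_decomp n hn y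
    conv_rhs => rw [hk, hl, h.shift]
    exact ⟨h.symm _ _, h.symm _ _⟩
  have hneg : ∀ x, negBlock (π.part (cst n hn x)) = π.part (cst n hn (x + n)) := by
    intro x
    ext w
    simp only [negBlock, Finset.mem_image]
    constructor
    · rintro ⟨v, hv, rfl⟩
      rw [← cst_nat n hn v, π.mem_part_iff_part_eq_part (by simp) (by simp)] at hv
      rw [← cst_nat n hn v, negB_cst, π.mem_part_iff_part_eq_part (by simp) (by simp)]
      exact (hrel _ _).2 (h.per _ _ ((hrel _ _).1 hv))
    · intro hw
      refine ⟨cst n hn (w.val - n), ?_, ?_⟩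
      · rw [π.mem_part_iff_part_eq_part (by simp) (by simp)]
        refine (hrel _ _).2 ((h.add_iff _ _).1 ((hrel _ _).1 ?_))
        rw [← cst_nat n hn w, π.mem_part_iff_part_eq_part (by simp) (by simp)] at hw
        unfold rel
        rw [sub_add_cancel]
        exact hw
      · rw [negB_cst, sub_add_cancel, cst_nat]
  refine ⟨π, mem_NCB.2 ⟨?_, ?_, ?_⟩, hrel⟩
  · intro a b c d h1 h2 h3 B hB C hC ha hc hb hd
    have eB1 := π.part_eq_of_mem hB ha
    have eB2 := π.part_eq_of_mem hB hc
    have eC1 := π.part_eq_of_mem hC hb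
    have eC2 := π.part_eq_of_mem hC hd
    have hac : rel n hn π a.val c.val := by
      unfold rel; rw [cst_nat, cst_nat, eB1, eB2]
    have hbd : rel n hn π b.val d.val := by
      unfold rel; rw [cst_nat, cst_nat, eC1, eC2]
    rw [Fin.lt_def] at h1 h2 h3
    have := d.isLt
    have hab := (hrel _ _).2 (h.nc a.val b.val c.val d.val (by omega) (by omega) (by omega)
      (by omega) ((hrel _ _).1 hac) ((hrel _ _).1 hbd))
    unfold rel at hab
    rw [cst_nat, cst_nat, eB1, eC1] at hab
    exact hab
  · intro B hB
    obtain ⟨x, rfl⟩ := parts_eq_part hn hB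
    rw [hneg]; simp
  · rw [Finset.card_le_one]
    intro A hA B hB
    simp only [Finset.mem_filter] at hA hB
    obtain ⟨hA, hA'⟩ := hA
    obtain ⟨hB, hB'⟩ := hB
    obtain ⟨x, rfl⟩ := parts_eq_part hn hA
    obtain ⟨y, rfl⟩ := parts_eq_part hn hB
    rw [hneg] at hA' hB'
    exact (hrel _ _).2 (h.zero x y ((hrel _ _).1 hA'.symm) ((hrel _ _).1 hB'.symm))

/-- Opener relation of a partition. -/
def opP (n : ℕ) (hn : 1 ≤ n) (π : Finpartition (Finset.univ : Finset (Fin (2 * n)))) :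
    ℤ → ℤ → Prop := opR n (rel n hn π)

/-- Size of the block of an opener. -/
lemma card_part_opener {n : ℕ} (hn : 1 ≤ n)
    {π : Finpartition (Finset.univ : Finset (Fin (2 * n)))} (h : π ∈ NCB n) {t : ℤ}
    (ht : opP n hn π t t) : (π.part (cst n hn t)).card = opSize n (opP n hn π) t := by
  classical
  have hG := rel_good hn h
  have hO : IsOp n (opP n hn π) := opR_isOp hn hG
  symm
  unfold opSize
  apply Finset.card_bij (fun y _ => cst n hn y)
  · intro y hy
    simp only [Finset.mem_filter, Finset.mem_Ico] at hy
    rw [π.mem_part_iff_part_eq_part (by simp) (by simp)]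
    exact hy.2.2.2.1.symm
  · intro y hy z hz e
    simp only [Finset.mem_filter, Finset.mem_Ico] at hy hz
    exact cst_inj n hn y z e (by omega) (by omega)
  · intro v hv
    rw [← cst_nat n hn v, π.mem_part_iff_part_eq_part (by simp) (by simp)] at hv
    have hr : rel n hn π t v.val := hv.symm
    rw [← relOf_opR hn hG] at hr
    rcases hr with ⟨i, k, h1, h2⟩ | ⟨h1, h2⟩
    · have e := hO.uniq _ _ _ h1 ht
      subst e
      have h3 : opP n hn π i (v.val + 2 * n * (-k)) := by
        have := (hO.per2k (i + 2 * n * k) v.val (-k)).2 h2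
        have e : i + 2 * n * k + 2 * n * (-k) = i := by ring
        rwa [e] at this
      refine ⟨v.val + 2 * n * (-k), ?_, by rw [cst_shift, cst_nat]⟩
      simp only [Finset.mem_filter, Finset.mem_Ico]
      exact ⟨⟨hO.le _ _ h3, hO.lt _ _ h3⟩, h3⟩
    · exact absurd ht (h1 t)

lemma opener_of_pos {n : ℕ} {Op : ℤ → ℤ → Prop} (hO : IsOp n Op) {t : ℤ}
    (ht : 1 ≤ opSize n Op t) : Op t t := by
  classical
  unfold opSize at ht
  obtain ⟨y, hy⟩ := Finset.card_pos.1 ht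
  simp only [Finset.mem_filter] at hy
  exact hO.refl hy.2

/-- Nonzero blocks are blocks of openers in `[0, 2n)`. -/
lemma nonzero_block {n : ℕ} (hn : 1 ≤ n)
    {π : Finpartition (Finset.univ : Finset (Fin (2 * n)))} (h : π ∈ NCB n)
    {B : Finset (Fin (2 * n))} (hB : B ∈ π.parts) (hB' : negBlock B ≠ B) :
    ∃ t : ℤ, 0 ≤ t ∧ t < 2 * n ∧ opP n hn π t t ∧ B = π.part (cst n hn t) := by
  have hG := rel_good hn h
  have hO : IsOp n (opP n hn π) := opR_isOp hn hG
  obtain ⟨x, rfl⟩ := parts_eq_part hn hB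
  rw [negBlock_part hn (mem_NCB.1 h).2.1] at hB'
  obtain ⟨i, hi⟩ := opR_exists hn hG (x := x) (fun e => hB' e.symm)
  obtain ⟨k, hk⟩ := cst_decomp n hn i
  have hlt := (cst n hn i).isLt
  refine ⟨(cst n hn i).val, by omega, by omega, ?_, ?_⟩
  · rw [← hO.per2k _ _ k, ← hk]
    exact hO.refl hi
  · rw [cst_nat]
    exact hi.2.2.1.symm

open Classical in
lemma card_nonzero {n : ℕ} (hn : 1 ≤ n)
    {π : Finpartition (Finset.univ : Finset (Fin (2 * n)))} (h : π ∈ NCB n) {i : ℕ}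
    (hi : 1 ≤ i) :
    (π.parts.filter (fun B => negBlock B ≠ B ∧ B.card = i)).card =
      2 * ((Finset.univ : Finset (Fin n)).filter
        (fun j => opSize n (opP n hn π) (j.val : ℤ) = i)).card := by
  have hG := rel_good hn h
  have hO : IsOp n (opP n hn π) := opR_isOp hn hG
  have h1 : ((Finset.Ico (0:ℤ) (2 * n)).filter (fun t => opSize n (opP n hn π) t = i)).card =
      (π.parts.filter (fun B => negBlock B ≠ B ∧ B.card = i)).card := by
    apply Finset.card_bij (fun t _ => π.part (cst n hn t))
    · intro t ht
      simp only [Finset.mem_filter, Finset.mem_Ico] at ht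
      have htt := opener_of_pos hO (t := t) (by omega)
      simp only [Finset.mem_filter]
      refine ⟨by simp, ?_, ?_⟩
      · rw [negBlock_part hn (mem_NCB.1 h).2.1]
        exact fun e => htt.2.2.2.1 e.symm
      · rw [card_part_opener hn h htt]; exact ht.2
    · intro t ht t' ht' e
      simp only [Finset.mem_filter, Finset.mem_Ico] at ht ht'
      have htt := opener_of_pos hO (t := t) (by omega)
      have htt' := opener_of_pos hO (t := t') (by omega)
      have hr : rel n hn π t t' := e
      rw [← relOf_opR hn hG] at hr
      rcases hr with ⟨i, k, h1, h2⟩ | ⟨h1, h2⟩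
      · have e1 := hO.uniq _ _ _ h1 htt
        have e2 := hO.uniq _ _ _ h2 htt'
        apply cst_inj n hn t t' _ (by omega) (by omega)
        rw [← e2, ← e1, cst_shift]
      · exact absurd htt (h1 t)
    · intro B hB
      simp only [Finset.mem_filter] at hB
      obtain ⟨t, h1, h2, h3, rfl⟩ := nonzero_block hn h hB.1 hB.2.1
      refine ⟨t, ?_, rfl⟩
      simp only [Finset.mem_filter, Finset.mem_Ico]
      exact ⟨⟨h1, h2⟩, by rw [← card_part_opener hn h h3]; exact hB.2.2⟩
  have h2 : ((Finset.univ : Finset (Fin n)).filter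
        (fun j => opSize n (opP n hn π) (j.val : ℤ) = i)).card =
      ((Finset.Ico (0:ℤ) n).filter (fun t => opSize n (opP n hn π) t = i)).card := by
    apply Finset.card_bij (fun (j : Fin n) _ => (j.val : ℤ))
    · intro j hj
      simp only [Finset.mem_filter, Finset.mem_Ico] at hj ⊢
      exact ⟨by have := j.isLt; omega, hj.2⟩
    · intro j _ k _ e
      apply Fin.ext; omega
    · intro t ht
      simp only [Finset.mem_filter, Finset.mem_Ico] at ht
      refine ⟨⟨t.toNat, by omega⟩, ?_, by simp; omega⟩
      have : ((t.toNat : ℕ) : ℤ) = t := by omega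
      simp only [Finset.mem_filter, this]
      exact ⟨by simp, ht.2⟩
  have h3 : ((Finset.Ico (n:ℤ) (2 * n)).filter (fun t => opSize n (opP n hn π) t = i)).card =
      ((Finset.Ico (0:ℤ) n).filter (fun t => opSize n (opP n hn π) t = i)).card := by
    symm
    apply Finset.card_bij (fun (y : ℤ) _ => y + (n : ℤ))
    · intro y hy
      simp only [Finset.mem_filter, Finset.mem_Ico] at hy ⊢
      rw [opSize_per n _ hO]
      exact ⟨by omega, hy.2⟩
    · intro y _ z _ e; omega
    · intro y hy
      simp only [Finset.mem_filter, Finset.mem_Ico] at hy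
      refine ⟨y - n, ?_, by ring⟩
      simp only [Finset.mem_filter, Finset.mem_Ico]
      rw [← opSize_per n _ hO, sub_add_cancel]
      exact ⟨by omega, hy.2⟩
  have h4 : (Finset.Ico (0:ℤ) (2 * n)) = Finset.Ico (0:ℤ) n ∪ Finset.Ico (n:ℤ) (2 * n) := by
    ext y; simp; omega
  rw [← h1, h2, h4, Finset.filter_union, Finset.card_union_of_disjoint, h3]
  · ring
  · apply Finset.disjoint_filter_filter
    rw [Finset.disjoint_left]
    intro y; simp; omega

/-! ### Counting functions with given fibre sizes -/

lemma card_functions (n N : ℕ) (k : Fin N → ℕ) (hk : ∑ i, k i = n) :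
    ((Finset.univ : Finset (Fin n → Fin N)).filter
      (fun g => ∀ i, ((Finset.univ : Finset (Fin n)).filter (fun j => g j = i)).card = k i)).card *
      ∏ i, Nat.factorial (k i) = Nat.factorial n := by
  classical
  have hcard : Fintype.card (Fin n) = Fintype.card (Σ i : Fin N, Fin (k i)) := by
    simp [hk]
  let e : Fin n ≃ Σ i : Fin N, Fin (k i) := Fintype.equivOfCardEq hcard
  let g0 : Fin n → Fin N := fun j => (e j).1
  have fib : ∀ i, Fintype.card {j // g0 j = i} = k i := by
    intro i
    have e1 : {j // g0 j = i} ≃ {p : Σ i : Fin N, Fin (k i) // p.1 = i} :=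
      e.subtypeEquiv (fun j => Iff.rfl)
    have e2 : {p : Σ i : Fin N, Fin (k i) // p.1 = i} ≃ Fin (k i) :=
      Equiv.sigmaSubtype i
    rw [Fintype.card_congr (e1.trans e2), Fintype.card_fin]
  set S := ((Finset.univ : Finset (Fin n → Fin N)).filter
      (fun g => ∀ i, ((Finset.univ : Finset (Fin n)).filter (fun j => g j = i)).card = k i))
    with hS
  have hfibers : ∀ g ∈ S, ((Finset.univ : Finset (Equiv.Perm (Fin n))).filter
      (fun σ : Equiv.Perm (Fin n) => g0 ∘ (σ : Fin n → Fin n) = g)).card = ∏ i, Nat.factorial (k i) := by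
    intro g hg
    simp only [hS, Finset.mem_filter, Finset.mem_univ, true_and] at hg
    have hne : ∀ i, Nonempty ({j // g j = i} ≃ {j // g0 j = i}) := by
      intro i
      refine ⟨Fintype.equivOfCardEq ?_⟩
      rw [fib, Fintype.card_subtype, hg]
    let τ : Equiv.Perm (Fin n) := Equiv.ofFiberEquiv (fun i => (hne i).some)
    have hτ : ∀ j, g0 (τ j) = g j := fun j => Equiv.ofFiberEquiv_map _ j
    have h1 := DomMulAct.stabilizer_card g0
    simp only [fib] at h1
    rw [← h1, Fintype.card_subtype]
    apply Finset.card_bij (fun σ _ => τ.symm.trans σ)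
    · intro σ hσ
      simp only [Finset.mem_filter, Finset.mem_univ, true_and] at hσ ⊢
      funext j
      have := congrFun hσ (τ.symm j)
      simp only [Function.comp] at this ⊢
      rw [Equiv.trans_apply, this, ← hτ]; simp
    · intro σ _ σ' _ h
      ext j
      have := congrArg (fun ρ : Equiv.Perm (Fin n) => ρ (τ j)) h
      simp at this
      rw [this]
    · intro ρ hρ
      refine ⟨τ.trans ρ, ?_, ?_⟩
      · simp only [Finset.mem_filter, Finset.mem_univ, true_and] at hρ ⊢
        funext j
        have := congrFun hρ (τ j)
        simp only [Function.comp] at this ⊢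
        rw [Equiv.trans_apply, this, hτ]
      · ext j; simp
  have hmaps : ∀ σ ∈ (Finset.univ : Finset (Equiv.Perm (Fin n))),
      (fun σ : Equiv.Perm (Fin n) => g0 ∘ (σ : Fin n → Fin n)) σ ∈ S := by
    intro σ _
    simp only [hS, Finset.mem_filter, Finset.mem_univ, true_and]
    intro i
    rw [← fib i, ← Fintype.card_subtype]
    exact Fintype.card_congr (σ.subtypeEquiv (fun j => Iff.rfl))
  have := Finset.card_eq_sum_card_fiberwise hmaps
  rw [Finset.sum_congr rfl hfibers, Finset.sum_const, smul_eq_mul, Finset.card_univ,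
    Fintype.card_perm, Fintype.card_fin] at this
  exact this.symm

lemma sum_Icc_fin (n : ℕ) (F : ℕ → ℕ) : ∑ i ∈ Finset.Icc 1 n, F i = ∑ i : Fin n, F (i + 1) := by
  rw [Fin.sum_univ_eq_sum_range (fun i => F (i + 1)), Finset.range_eq_Ico,
    Finset.sum_Ico_add' F 0 n 1]
  rfl

lemma prod_Icc_fin (n : ℕ) (F : ℕ → ℕ) :
    ∏ i ∈ Finset.Icc 1 n, F i = ∏ i : Fin n, F (i + 1) := by
  rw [Fin.prod_univ_eq_prod_range (fun i => F (i + 1)), Finset.range_eq_Ico,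
    Finset.prod_Ico_add' F 0 n 1]
  rfl

lemma per_ext {n : ℕ} (hn : 1 ≤ n) {f g : ℤ → ℕ} (hf : ∀ t, f (t + n) = f t)
    (hg : ∀ t, g (t + n) = g t) (h : ∀ j : Fin n, f (j.val : ℤ) = g (j.val : ℤ)) : f = g := by
  funext t
  have l1 := Int.emod_nonneg t (show (n : ℤ) ≠ 0 by omega)
  have l2 := Int.emod_lt_of_pos t (show (n : ℤ) > 0 by omega)
  have e := Int.emod_add_mul_ediv t n
  have pf : Function.Periodic f (n : ℤ) := hf
  have pg : Function.Periodic g (n : ℤ) := hg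
  have h1 := (pf.int_mul (t / n)) (t % n)
  have h2 := (pg.int_mul (t / n)) (t % n)
  have e' : t % n + (t / n : ℤ) * n = t := by rw [mul_comm]; exact e
  simp only [Int.cast_id] at h1 h2
  rw [e'] at h1 h2
  rw [h1, h2]
  have := h ⟨(t % n).toNat, by omega⟩
  simp only [Int.toNat_of_nonneg l1] at this
  exact this

/-- The zero-block size is forced by the pair counts. -/
lemma zeroBlockSize_eq {n : ℕ} (hn : 1 ≤ n)
    {π : Finpartition (Finset.univ : Finset (Fin (2 * n)))} (h : π ∈ NCB n) (s : ℕ) (r : ℕ → ℕ)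
    (hsum : s + ∑ i ∈ Finset.Icc 1 n, i * r i = n)
    (hr : ∀ i ∈ Finset.Icc 1 n,
      (π.parts.filter (fun B => negBlock B ≠ B ∧ B.card = i)).card = 2 * r i) :
    zeroBlockSize π = 2 * s := by
  classical
  have hG := rel_good hn h
  have hO : IsOp n (opP n hn π) := opR_isOp hn hG
  have h1 := π.sum_card_parts
  rw [Finset.card_univ, Fintype.card_fin] at h1
  rw [← Finset.sum_filter_add_sum_filter_not π.parts (fun B => negBlock B = B)] at h1
  have hmaps : ∀ B ∈ π.parts.filter (fun B => ¬ negBlock B = B), B.card ∈ Finset.Icc 1 n := by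
    intro B hB
    simp only [Finset.mem_filter] at hB
    rw [Finset.mem_Icc]
    refine ⟨Finset.card_pos.2 (π.nonempty_of_mem_parts hB.1), ?_⟩
    obtain ⟨t, _, _, h3, rfl⟩ := nonzero_block hn h hB.1 hB.2
    rw [card_part_opener hn h h3]
    unfold opSize
    refine (Finset.card_filter_le _ _).trans ?_
    simp
  have h2 : ∑ B ∈ π.parts.filter (fun B => ¬ negBlock B = B), B.card =
      ∑ i ∈ Finset.Icc 1 n, 2 * (i * r i) := by
    rw [← Finset.sum_fiberwise_of_maps_to hmaps]
    apply Finset.sum_congr rfl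
    intro i hi
    rw [Finset.filter_filter, Finset.sum_congr rfl (g := fun _ => i), Finset.sum_const,
      smul_eq_mul]
    · have := hr i hi
      simp only [ne_eq] at this
      rw [this]; ring
    · intro B hB
      simp only [Finset.mem_filter] at hB
      exact hB.2.2
  rw [h2, ← Finset.mul_sum] at h1
  unfold zeroBlockSize
  omega

lemma opSize_le (n : ℕ) (Op : ℤ → ℤ → Prop) (t : ℤ) : opSize n Op t < n + 1 := by
  classical
  unfold opSize
  refine Nat.lt_succ_of_le ((Finset.card_filter_le _ _).trans ?_)
  simp

/-- **Athanasiadis' formula.** For `s + r_1 + 2 r_2 + ⋯ + n r_n = n` and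
`m = r_1 + ⋯ + r_n`, the number of type `B_n` non-crossing partitions with exactly `r_i`
unordered pairs `{V, -V}` of non-zero blocks with `|V| = i` for each `i`, and a zero-block
of cardinality `2s` (no zero-block when `s = 0`), equals `n! / (r_1! ⋯ r_n! (n - m)!)`. -/
theorem typeB_number_of_blocks_of_given_type (n : ℕ) (hn : 1 ≤ n) (s : ℕ) (r : ℕ → ℕ)
    (hsum : s + ∑ i ∈ Finset.Icc 1 n, i * r i = n)
    (m : ℕ) (hm : m = ∑ i ∈ Finset.Icc 1 n, r i) :
    (fil (NCB n) (fun π => zeroBlockSize π = 2 * s ∧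
          ∀ i ∈ Finset.Icc 1 n, pairCount π i = r i)).card *
        (∏ i ∈ Finset.Icc 1 n, Nat.factorial (r i)) * Nat.factorial (n - m) =
      Nat.factorial n := by
  classical
  have hmn : m ≤ n := by
    rw [hm]
    refine le_trans (Finset.sum_le_sum (g := fun i => i * r i) ?_) (by omega)
    intro i hi
    rw [Finset.mem_Icc] at hi
    exact Nat.le_mul_of_pos_left _ hi.1
  let k : Fin (n + 1) → ℕ := Fin.cons (n - m) (fun i : Fin n => r (i + 1))
  have hk0 : k 0 = n - m := rfl
  have hks : ∀ i : Fin n, k i.succ = r (i + 1) := fun i => rfl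
  have hksum : ∑ i, k i = n := by
    rw [Fin.sum_univ_succ, hk0]
    simp only [hks]
    rw [← sum_Icc_fin, ← hm]; omega
  have hkprod : ∏ i, Nat.factorial (k i) =
      (∏ i ∈ Finset.Icc 1 n, Nat.factorial (r i)) * Nat.factorial (n - m) := by
    rw [Fin.prod_univ_succ, hk0]
    simp only [hks]
    rw [prod_Icc_fin, mul_comm]
  have hcount := card_functions n (n + 1) k hksum
  rw [hkprod, ← mul_assoc] at hcount
  rw [← hcount]
  congr 2
  have hmem : ∀ π, π ∈ fil (NCB n) (fun π => zeroBlockSize π = 2 * s ∧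
          ∀ i ∈ Finset.Icc 1 n, pairCount π i = r i) ↔ π ∈ NCB n ∧ zeroBlockSize π = 2 * s ∧
          ∀ i ∈ Finset.Icc 1 n, pairCount π i = r i := by
    intro π; simp [fil]
  have hpair : ∀ π ∈ NCB n, ∀ i, 1 ≤ i → pairCount π i =
      ((Finset.univ : Finset (Fin n)).filter
        (fun j => opSize n (opP n hn π) (j.val : ℤ) = i)).card := by
    intro π hπ i hi
    have := card_nonzero hn hπ hi
    unfold pairCount
    have e : (π.parts.filter (fun B => negBlock B ≠ B ∧ B.card = i)).card =
      2 * ((Finset.univ : Finset (Fin n)).filter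
        (fun j => opSize n (opP n hn π) (j.val : ℤ) = i)).card := by
      convert this
    omega
  -- membership in the set of functions only has to be checked at nonzero values
  have hfun : ∀ g : Fin n → Fin (n + 1), (∀ i : Fin n,
      ((Finset.univ : Finset (Fin n)).filter (fun j => g j = i.succ)).card = r (i + 1)) →
      ∀ i, ((Finset.univ : Finset (Fin n)).filter (fun j => g j = i)).card = k i := by
    intro g hg i
    refine Fin.cases ?_ ?_ i
    · have h1 := Finset.card_eq_sum_card_fiberwise (s := (Finset.univ : Finset (Fin n)))
        (t := (Finset.univ : Finset (Fin (n + 1)))) (f := g) (by intro x _; simp)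
      rw [Fin.sum_univ_succ] at h1
      simp only [hg] at h1
      rw [← sum_Icc_fin, ← hm, Finset.card_univ, Fintype.card_fin] at h1
      rw [hk0]; omega
    · intro j
      rw [hg, hks]
  apply Finset.card_bij (fun π _ => fun j : Fin n =>
    (⟨opSize n (opP n hn π) (j.val : ℤ), opSize_le _ _ _⟩ : Fin (n + 1)))
  · intro π hπ
    obtain ⟨h1, _, h3⟩ := (hmem π).1 hπ
    simp only [Finset.mem_filter, Finset.mem_univ, true_and]
    apply hfun
    intro i
    have h4 := h3 (i + 1) (by have := i.isLt; rw [Finset.mem_Icc]; omega)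
    rw [hpair π h1 _ (by omega)] at h4
    rw [← h4]
    congr 1
    ext j
    simp [Fin.ext_iff]
  · intro π hπ σ hσ e
    have h1 := ((hmem π).1 hπ).1
    have h2 := ((hmem σ).1 hσ).1
    have hG1 := rel_good hn h1
    have hG2 := rel_good hn h2
    have hO1 : IsOp n (opP n hn π) := opR_isOp hn hG1
    have hO2 : IsOp n (opP n hn σ) := opR_isOp hn hG2
    have hs : opSize n (opP n hn π) = opSize n (opP n hn σ) := by
      apply per_ext hn (opSize_per n _ hO1) (opSize_per n _ hO2)
      intro j
      have := congrFun e j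
      simpa [Fin.ext_iff] using this
    have ho : opP n hn π = opP n hn σ := by
      funext i x
      rw [← propext (hO1.opOf_eq i x), ← propext (hO2.opOf_eq i x), hs]
    apply rel_inj hn
    intro x y
    rw [← relOf_opR hn hG1, ← relOf_opR hn hG2]
    change relOf n (opP n hn π) x y ↔ relOf n (opP n hn σ) x y
    rw [ho]
  · intro g hg
    simp only [Finset.mem_filter, Finset.mem_univ, true_and] at hg
    have hlt : ∀ t : ℤ, (t % (n : ℤ)).toNat < n := by
      intro t
      have l1 := Int.emod_nonneg t (show (n : ℤ) ≠ 0 by omega)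
      have l2 := Int.emod_lt_of_pos t (show (n : ℤ) > 0 by omega)
      omega
    let f : ℤ → ℕ := fun t => (g ⟨(t % (n : ℤ)).toNat, hlt t⟩).val
    have hf : ∀ t, f (t + n) = f t := by
      intro t
      simp [f]
    have hfj : ∀ j : Fin n, f (j.val : ℤ) = (g j).val := by
      intro j
      have : ((j.val : ℤ) % (n : ℤ)).toNat = j.val := by
        have := j.isLt
        rw [Int.emod_eq_of_lt (by omega) (by omega)]; omega
      simp only [f, this]
    have hfsum : ∑ j : Fin n, (g j).val ≤ n := by
      have : ∑ j : Fin n, (g j).val = ∑ i : Fin (n + 1), k i * i.val := by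
        rw [← Finset.sum_fiberwise_of_maps_to (s := (Finset.univ : Finset (Fin n)))
          (t := (Finset.univ : Finset (Fin (n + 1)))) (g := g) (by intro x _; simp)]
        apply Finset.sum_congr rfl
        intro i _
        rw [Finset.sum_congr rfl (g := fun _ => i.val), Finset.sum_const, smul_eq_mul, hg]
        intro j hj
        simp only [Finset.mem_filter] at hj
        rw [hj.2]
      rw [this, Fin.sum_univ_succ]
      simp only [hks, Fin.val_succ, Fin.val_zero, mul_zero, zero_add]
      rw [← sum_Icc_fin n (fun i => r i * i)]
      have e : ∑ i ∈ Finset.Icc 1 n, r i * i = ∑ i ∈ Finset.Icc 1 n, i * r i :=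
        Finset.sum_congr rfl (fun i _ => mul_comm _ _)
      omega
    have hs : hgt f n ≤ 0 := by
      have h1 := hgt_diff f 0 n (by omega)
      have h2 : hgt f 0 = 0 := by simp [hgt]
      have h3 : ∑ t ∈ Finset.Ico (0:ℤ) n, f t = ∑ j : Fin n, (g j).val := by
        symm
        apply Finset.sum_bij (fun (j : Fin n) _ => (j.val : ℤ))
        · intro j _
          rw [Finset.mem_Ico]; have := j.isLt; omega
        · intro j _ l _ e
          apply Fin.ext; omega
        · intro t ht
          rw [Finset.mem_Ico] at ht
          exact ⟨⟨t.toNat, by omega⟩, by simp, by simp; omega⟩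
        · intro j _
          rw [hfj]
      have h4 : ∑ t ∈ Finset.Ico (0:ℤ) n, (f t : ℤ) ≤ n := by
        rw [← Nat.cast_sum, h3]; exact_mod_cast hfsum
      rw [h1, h2]
      linarith
    have hO := opOf_isOp n hn f hf hs
    obtain ⟨π, hπ, hrel⟩ := rel_surj hn (relOf_good hn hO)
    have hop : opP n hn π = opOf f := by
      have : rel n hn π = relOf n (opOf f) := by
        funext x y; exact propext (hrel x y)
      funext i x
      unfold opP
      rw [this]
      exact propext (opR_relOf hn hO i x)
    have hsz : ∀ t, opSize n (opP n hn π) t = f t := by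
      intro t
      rw [hop, opSize_opOf n f hf hn hs]
    have hcnt : ∀ i ∈ Finset.Icc 1 n, ((Finset.univ : Finset (Fin n)).filter
        (fun j => opSize n (opP n hn π) (j.val : ℤ) = i)).card = r i := by
      intro i hi
      rw [Finset.mem_Icc] at hi
      have h1 := hg (Fin.succ ⟨i - 1, by omega⟩)
      rw [hks] at h1
      have e : i - 1 + 1 = i := by omega
      simp only [e] at h1
      rw [← h1]
      congr 1
      ext j
      simp [Fin.ext_iff, hsz, hfj, e]
    refine ⟨π, (hmem π).2 ⟨hπ, ?_, ?_⟩, ?_⟩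
    · apply zeroBlockSize_eq hn hπ s r hsum
      intro i hi
      rw [← hcnt i hi]
      have := card_nonzero hn hπ (Finset.mem_Icc.1 hi).1
      convert this
    · intro i hi
      rw [hpair π hπ i (Finset.mem_Icc.1 hi).1]
      exact hcnt i hi
    · funext j
      apply Fin.ext
      simp only [hsz, hfj]
end

section
/- Let n ≥ 1, k ≥ 1, and 1 ≤ t ≤ n be integers. The sum, over all partitions π in NC^k(n), of the number of blocks of π of size tk, equals binom(n(k+1) − t − 1, nk − 1). -/
open Finset

/-- `NC n` : the set of non-crossing partitions of `{1,…,n}`. -/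
noncomputable def NC (n : ℕ) : Finset (Finpartition (Finset.univ : Finset (Fin n))) :=
  fil Finset.univ IsNoncrossing

/-- `NCdiv k n` : the set of `k`-divisible non-crossing partitions of `{1,…,kn}`
(all blocks have size divisible by `k`). -/
noncomputable def NCdiv (k n : ℕ) : Finset (Finpartition (Finset.univ : Finset (Fin (k * n)))) :=
  fil Finset.univ (fun π => IsNoncrossing π ∧ ∀ B ∈ π.parts, k ∣ B.card)

/-- `NCeq k n` : the set of `k`-equal non-crossing partitions of `{1,…,kn}`
(all blocks have size exactly `k`). -/
noncomputable def NCeq (k n : ℕ) : Finset (Finpartition (Finset.univ : Finset (Fin (k * n)))) :=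
  fil Finset.univ (fun π => IsNoncrossing π ∧ ∀ B ∈ π.parts, B.card = k)

/-- The number of blocks of `π` of size `i`. -/
def blockCount {n : ℕ} (π : Finpartition (Finset.univ : Finset (Fin n))) (i : ℕ) : ℕ :=
  (π.parts.filter (fun B => B.card = i)).card


theorem card_fix (N n t : ℕ) (hN : 1 ≤ N) (ht : t ≤ n) (i : ZMod (N+1)) :
   #{g ∈ piAntidiag (univ : Finset (ZMod (N+1))) n | g i = t} = (N + n - t - 1).choose (N-1) := by
  have h1 := Finset.card_finsuppAntidiag_nat_eq_choose (s := univ.erase i) (n - t)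
  have h2 : #(univ.erase i) = N := by
    rw [card_erase_of_mem (mem_univ _), card_univ, ZMod.card]; omega
  rw [h2] at h1
  have h3 : (N + n - t - 1).choose (N-1) = (N + (n-t) - 1).choose (n - t) := by
    rw [← Nat.choose_symm_of_eq_add]
    · congr 1; omega
    · omega
  rw [h3, ← h1]
  symm
  apply Finset.card_bij (fun (f : ZMod (N+1) →₀ ℕ) _ => Function.update (f : ZMod (N+1) → ℕ) i t)
  · intro f hf
    rw [mem_finsuppAntidiag] at hf
    simp only [mem_filter, mem_piAntidiag, mem_univ, implies_true, and_true, Function.update_self]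
    rw [Finset.sum_update_of_mem (mem_univ i), sdiff_singleton_eq_erase, hf.1]; omega
  · intro f hf f' hf' h
    rw [mem_finsuppAntidiag] at hf hf'
    ext x
    by_cases hx : x = i
    · subst hx
      have a : x ∉ f.support := fun h => by simpa using hf.2 h
      have b : x ∉ f'.support := fun h => by simpa using hf'.2 h
      simp at a b; rw [a, b]
    · have := congrFun h x
      simpa [hx] using this
  · intro g hg
    simp only [mem_filter, mem_piAntidiag, mem_univ, implies_true, and_true] at hg
    refine ⟨Finsupp.equivFunOnFinite.symm (Function.update g i 0), ?_, ?_⟩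
    · rw [mem_finsuppAntidiag]
      constructor
      · have : univ.sum g = g i + ∑ x ∈ univ.erase i, g x := by
          rw [Finset.add_sum_erase _ _ (mem_univ i)]
        have h : ∑ x ∈ univ.erase i, (Function.update g i 0) x = ∑ x ∈ univ.erase i, g x := by
          apply sum_congr rfl; intro x hx; simp at hx; simp [hx]
        simp only [Finsupp.equivFunOnFinite_symm_apply_apply, h]; omega
      · intro x hx
        simp at hx ⊢
        rintro rfl; simp at hx
    · ext x
      by_cases hx : x = i
      · subst hx; simp [hg.2]
      · simp [hx]

/-- valid -/
def Valid (N k : ℕ) (g : ZMod (N+1) → ℕ) : Prop :=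
  ∀ j, j ≤ N → j ≤ k * ∑ i ∈ range j, g (i : ZMod (N+1))

theorem sum_zmod (N : ℕ) (g : ZMod (N+1) → ℕ) : ∑ z, g z = ∑ i ∈ range (N+1), g (i : ZMod (N+1)) := by
  have := Fin.sum_univ_eq_sum_range (fun i => g (i : ZMod (N+1))) (N+1)
  rw [← this]
  change ∑ z : Fin (N+1), g z = _
  apply sum_congr rfl
  intro z _
  congr 1
  exact (ZMod.natCast_zmod_val (n := N+1) z).symm

theorem cyc (N n k : ℕ) (hN : N = k * n) (g : ZMod (N+1) → ℕ) (hg : ∑ z, g z = n) :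
    ∃! r : ZMod (N+1), Valid N k (fun z => g (z + r)) := by
  set T : ℕ → ℤ := fun j => k * ((∑ i ∈ range j, g (i : ZMod (N+1)) : ℕ) : ℤ) - j with hT
  have per : ∀ j, T (j + (N+1)) = T j - 1 := by
    intro j
    have : ∑ i ∈ range (j + (N+1)), g (i : ZMod (N+1)) = n + ∑ i ∈ range j, g (i : ZMod (N+1)) := by
      rw [add_comm j, sum_range_add, ← sum_zmod, hg]
      congr 1
      apply sum_congr rfl
      intro i _
      congr 1
      rw [Nat.cast_add]
      simp
    simp only [hT, this]
    push_cast
    have : (N : ℤ) = k * n := by exact_mod_cast hN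
    rw [this]; ring
  have val : ∀ r : ZMod (N+1), Valid N k (fun z => g (z + r)) ↔ ∀ j ≤ N, T r.val ≤ T (r.val + j) := by
    intro r
    unfold Valid
    apply forall₂_congr
    intro j hj
    have h : ∑ i ∈ range (r.val + j), g (i : ZMod (N+1)) =
      ∑ i ∈ range r.val, g (i : ZMod (N+1)) + ∑ i ∈ range j, g (i + r) := by
      rw [sum_range_add]
      congr 1
      apply sum_congr rfl
      intro i _
      congr 1
      rw [Nat.cast_add, ZMod.natCast_zmod_val, add_comm r]
    simp only [hT, h]
    push_cast
    rw [mul_add]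
    constructor
    · intro h
      have : (j:ℤ) ≤ k * ∑ x ∈ range j, (g (x + r) : ℤ) := by exact_mod_cast h
      linarith
    · intro h
      have : (j:ℤ) ≤ k * ∑ x ∈ range j, (g (x + r) : ℤ) := by linarith
      exact_mod_cast this
  have hex : ∃ r, r ≤ N ∧ ∀ j ≤ N, T r ≤ T j := by
    obtain ⟨r, hr, h⟩ := Finset.exists_min_image (range (N+1)) T ⟨0, by simp⟩
    simp only [mem_range] at hr h
    exact ⟨r, by omega, fun j hj => h j (by omega)⟩
  classical
  refine ⟨(Nat.find hex : ℕ), ?_, ?_⟩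
  · obtain ⟨h1, h2⟩ := Nat.find_spec hex
    have h3 : ∀ j < Nat.find hex, T (Nat.find hex) < T j := by
      intro j hj
      by_contra hc
      exact Nat.find_min hex hj ⟨by omega, fun l hl => by linarith [h2 l hl]⟩
    generalize Nat.find hex = r at *
    have hv : ((r : ZMod (N+1))).val = r := ZMod.val_natCast_of_lt (by omega)
    change Valid N k (fun z => g (z + (r : ZMod (N+1))))
    rw [val, hv]
    intro j hj
    by_cases hrj : r + j ≤ N
    · exact h2 _ hrj
    · obtain ⟨l, hl⟩ : ∃ l, r + j = l + (N+1) := ⟨r + j - (N+1), by omega⟩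
      rw [hl, per]
      have := h3 l (by omega)
      omega
  · have key : ∀ r s : ZMod (N+1), Valid N k (fun z => g (z + r)) → Valid N k (fun z => g (z + s)) →
        ¬ r.val < s.val := by
      intro r s hr hs hlt
      rw [val] at hr hs
      have := s.val_lt
      have a := hr (s.val - r.val) (by omega)
      have b := hs (r.val + (N+1) - s.val) (by omega)
      rw [show r.val + (s.val - r.val) = s.val by omega] at a
      rw [show s.val + (r.val + (N+1) - s.val) = r.val + (N+1) by omega, per] at b
      omega
    have h0 : Valid N k (fun z => g (z + (Nat.find hex : ℕ))) := by
      obtain ⟨h1, h2⟩ := Nat.find_spec hex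
      have h3 : ∀ j < Nat.find hex, T (Nat.find hex) < T j := by
        intro j hj
        by_contra hc
        exact Nat.find_min hex hj ⟨by omega, fun l hl => by linarith [h2 l hl]⟩
      generalize Nat.find hex = r at *
      have hv : ((r : ZMod (N+1))).val = r := ZMod.val_natCast_of_lt (by omega)
      rw [val, hv]
      intro j hj
      by_cases hrj : r + j ≤ N
      · exact h2 _ hrj
      · obtain ⟨l, hl⟩ : ∃ l, r + j = l + (N+1) := ⟨r + j - (N+1), by omega⟩
        rw [hl, per]
        have := h3 l (by omega)
        omega
    intro s hs
    apply ZMod.val_injective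
    have a := key _ _ hs h0
    have b := key _ _ h0 hs
    omega

open Classical in
theorem count_valid (N n k t : ℕ) (hN : N = k * n) (hN1 : 1 ≤ N) (ht : t ≤ n) :
    ∑ g ∈ (piAntidiag (univ : Finset (ZMod (N+1))) n).filter (Valid N k), #{z | g z = t}
      = (N + n - t - 1).choose (N-1) := by
  set A := piAntidiag (univ : Finset (ZMod (N+1))) n with hA
  have memA : ∀ g, g ∈ A ↔ ∑ z, g z = n := by simp [hA]
  have h1 : ∑ g ∈ A, #{z | g z = t} = (N+1) * (N + n - t - 1).choose (N-1) := by
    simp_rw [card_filter]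
    rw [sum_comm]
    simp_rw [← card_filter]
    rw [sum_congr rfl (fun i _ => card_fix N n t hN1 ht i)]
    simp [ZMod.card]
  have h2 : ∑ g ∈ A, #{z | g z = t} = ∑ g ∈ A, ∑ r : ZMod (N+1),
      if Valid N k (fun z => g (z + r)) then #{z | g z = t} else 0 := by
    apply sum_congr rfl
    intro g hg
    obtain ⟨r, hr, hu⟩ := cyc N n k hN g ((memA g).1 hg)
    rw [Finset.sum_eq_single r]
    · rw [if_pos hr]
    · intro b _ hb
      rw [if_neg]
      exact fun h => hb (hu b h)
    · simp
  have h3 : ∀ r : ZMod (N+1), (∑ g ∈ A, if Valid N k (fun z => g (z + r)) then #{z | g z = t} else 0)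
     = ∑ g ∈ A.filter (Valid N k), #{z | g z = t} := by
    intro r
    rw [sum_filter]
    apply Finset.sum_bij' (fun g _ => fun z => g (z + r)) (fun g _ => fun z => g (z - r))
    · intro g hg
      rw [memA] at hg ⊢
      rw [← hg]
      exact Equiv.sum_comp (Equiv.addRight r) g
    · intro g hg
      rw [memA] at hg ⊢
      rw [← hg]
      exact Equiv.sum_comp (Equiv.subRight r) g
    · intro g _; simp
    · intro g _; simp
    · intro g _
      congr 1
      symm
      apply Finset.card_bij (fun z _ => z + r)
      · intro a; simp
      · intro a _ b _; simp
      · intro b hb; exact ⟨b - r, by simpa using hb, by simp⟩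
  rw [h2, sum_comm, sum_congr rfl (fun r _ => h3 r)] at h1
  simp only [sum_const, card_univ, ZMod.card, smul_eq_mul] at h1
  exact Nat.eq_of_mul_eq_mul_left (by omega) h1

/-- The minimum of the block of `i`. -/
def mn {N : ℕ} (π : Finpartition (Finset.univ : Finset (Fin N))) (i : Fin N) : Fin N :=
  (π.part i).min' ⟨i, by simp⟩

section
variable {N : ℕ} (π : Finpartition (Finset.univ : Finset (Fin N)))

theorem mn_mem (i : Fin N) : mn π i ∈ π.part i := Finset.min'_mem _ _

theorem mn_le (i : Fin N) : mn π i ≤ i := Finset.min'_le _ _ (by simp)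

theorem part_mn (i : Fin N) : π.part (mn π i) = π.part i :=
  (π.mem_part_iff_part_eq_part (mem_univ _) (mem_univ _)).1 (mn_mem π i)

theorem mn_congr {i j : Fin N} (h : π.part i = π.part j) : mn π i = mn π j := by
  unfold mn; congr 1

theorem mn_eq_iff {i j : Fin N} : mn π i = mn π j ↔ π.part i = π.part j := by
  refine ⟨fun h => ?_, mn_congr π⟩
  rw [← part_mn, h, part_mn]

theorem mn_mn (i : Fin N) : mn π (mn π i) = mn π i := mn_congr π (part_mn π i)

/-- The encoding: `enc π j` is the size of the block with minimum `j` (or `0`). -/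
def enc (j : ℕ) : ℕ := #{x : Fin N | (mn π x : ℕ) = j}

theorem enc_mn (i : Fin N) : enc π (mn π i) = #(π.part i) := by
  unfold enc
  congr 1
  ext x
  simp only [mem_filter, mem_univ, true_and]
  rw [π.mem_part_iff_part_eq_part (mem_univ _) (mem_univ _), ← mn_eq_iff]
  exact Fin.val_inj

theorem sum_enc (l : ℕ) : ∑ j ∈ range l, enc π j = #{x : Fin N | (mn π x : ℕ) < l} := by
  unfold enc
  rw [← Finset.card_biUnion]
  · congr 1; ext x; simp
  · intro a _ b _ hab
    rw [Function.onFun, Finset.disjoint_left]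
    intro x; simp; omega

theorem card_lt (l : ℕ) (hl : l ≤ N) : #{x : Fin N | (x : ℕ) < l} = l := by
  have : ({x : Fin N | (x : ℕ) < l} : Finset (Fin N)) = univ.map (Fin.castLEEmb hl) := by
    ext x
    simp only [mem_filter, mem_univ, true_and, mem_map, Fin.castLEEmb_apply]
    constructor
    · intro h; exact ⟨⟨x, h⟩, rfl⟩
    · rintro ⟨y, rfl⟩; simp
  rw [this]; simp

/-- The walk. -/
def walk (F : ℕ → ℕ) (j : ℕ) : ℤ := ((∑ i ∈ range j, F i : ℕ) : ℤ) - j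

theorem walk_succ (F : ℕ → ℕ) (j : ℕ) : walk F (j+1) = walk F j + F j - 1 := by
  unfold walk; rw [sum_range_succ]; push_cast; ring

theorem walk_enc (l : ℕ) (hl : l ≤ N) :
    walk (enc π) l = (#{x : Fin N | l ≤ (x : ℕ) ∧ (mn π x : ℕ) < l} : ℕ) := by
  unfold walk
  rw [sum_enc]
  have : #{x : Fin N | (mn π x : ℕ) < l} =
      #{x : Fin N | (x : ℕ) < l} + #{x : Fin N | l ≤ (x : ℕ) ∧ (mn π x : ℕ) < l} := by
    rw [← card_union_of_disjoint]
    · congr 1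
      ext x
      have := mn_le π x
      rw [Fin.le_def] at this
      simp only [mem_filter, mem_univ, true_and, mem_union]
      omega
    · rw [Finset.disjoint_left]
      intro x; simp; omega
  rw [this, card_lt l hl]; push_cast; ring

/-- `p` is the position at which the token popped at `i` was pushed. -/
def IsOwner (F : ℕ → ℕ) (i p : ℕ) : Prop :=
  p ≤ i ∧ walk F p ≤ walk F (i+1) ∧ ∀ l, p < l → l ≤ i → walk F (i+1) < walk F l

theorem IsOwner.unique {F : ℕ → ℕ} {i p q : ℕ} (hp : IsOwner F i p) (hq : IsOwner F i q) : p = q := by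
  obtain ⟨a, b, c⟩ := hp
  obtain ⟨a', b', c'⟩ := hq
  rcases lt_trichotomy p q with h | h | h
  · have := c q h a'; omega
  · exact h
  · have := c' p h a; omega

theorem nc_mn (h : IsNoncrossing π) {a b c d : Fin N} (hab : a < b) (hbc : b < c) (hcd : c < d)
    (h1 : mn π a = mn π c) (h2 : mn π b = mn π d) : mn π a = mn π b := by
  rw [mn_eq_iff] at *
  refine h a b c d hab hbc hcd _ (π.part_mem.2 (mem_univ a)) _ (π.part_mem.2 (mem_univ b)) ?_ ?_ ?_ ?_
  · simp
  · rw [h1]; simp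
  · simp
  · rw [h2]; simp

theorem isOwner_mn (h : IsNoncrossing π) (i : Fin N) : IsOwner (enc π) i (mn π i) := by
  have hle := mn_le π i
  have hmm := mn_mn π i
  refine ⟨hle, ?_, ?_⟩
  · rw [walk_enc _ _ (by omega), walk_enc _ _ (by omega)]
    norm_cast
    apply card_le_card
    intro x hx
    simp only [mem_filter, mem_univ, true_and] at hx ⊢
    obtain ⟨h1, h2⟩ := hx
    refine ⟨?_, by rw [Fin.le_def] at hle; omega⟩
    by_contra hc
    have hne : mn π x ≠ mn π i := by intro e; rw [e] at h2; omega
    have e1 : x ≠ i := by rintro rfl; exact hne rfl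
    have e2 : mn π i ≠ x := by
      intro e; apply hne; rw [← e]; exact hmm
    have a1 : mn π i < x := lt_of_le_of_ne h1 e2
    have a2 : x < i := by
      rw [Fin.lt_def]; have := Fin.val_ne_of_ne e1; omega
    have := nc_mn π h (a := mn π x) (b := mn π i) (c := x) (d := i) h2 a1 a2 (mn_mn π x) hmm
    rw [mn_mn, mn_mn] at this
    exact hne this
  · intro l hl1 hl2
    rw [walk_enc _ _ (by omega), walk_enc _ _ (by omega)]
    norm_cast
    apply card_lt_card
    rw [Finset.ssubset_iff_of_subset]
    · refine ⟨i, ?_, ?_⟩ <;> simp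
      exact ⟨hl2, hl1⟩
    · intro x hx
      simp only [mem_filter, mem_univ, true_and] at hx ⊢
      obtain ⟨h1, h2⟩ := hx
      refine ⟨by omega, ?_⟩
      by_contra hc
      have hne : mn π x ≠ mn π i := by intro e; rw [e] at hc; omega
      have e1 : mn π x ≠ i := by
        intro e; apply hne; rw [← e, mn_mn]
      have a1 : mn π i < mn π x := by rw [Fin.lt_def]; omega
      have a2 : mn π x < i := by
        rw [Fin.lt_def]; have := Fin.val_ne_of_ne e1; omega
      have a3 : i < x := by rw [Fin.lt_def]; omega
      have := nc_mn π h a1 a2 a3 hmm (mn_mn π x)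
      rw [mn_mn, mn_mn] at this
      exact hne this.symm

theorem enc_inj {π π' : Finpartition (Finset.univ : Finset (Fin N))} (h : IsNoncrossing π)
    (h' : IsNoncrossing π') (he : enc π = enc π') : π = π' := by
  have hm : ∀ i, mn π i = mn π' i := by
    intro i
    apply Fin.ext
    have := isOwner_mn π' h' i
    rw [← he] at this
    exact (isOwner_mn π h i).unique this
  have hp : ∀ i, π.part i = π'.part i := by
    intro i
    ext x
    rw [π.mem_part_iff_part_eq_part (mem_univ _) (mem_univ _),
      π'.mem_part_iff_part_eq_part (mem_univ _) (mem_univ _), ← mn_eq_iff, ← mn_eq_iff, hm, hm]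
  have key : ∀ ρ ρ' : Finpartition (Finset.univ : Finset (Fin N)), (∀ i, ρ.part i = ρ'.part i) →
      ρ.parts ⊆ ρ'.parts := by
    intro ρ ρ' hh B hB
    obtain ⟨x, hx⟩ := ρ.nonempty_of_mem_parts hB
    rw [← ρ.part_eq_of_mem hB hx, hh]
    exact ρ'.part_mem.2 (mem_univ x)
  apply Finpartition.ext
  exact Subset.antisymm (key _ _ hp) (key _ _ fun i => (hp i).symm)

theorem exists_owner (F : ℕ → ℕ) (hF : ∀ j ≤ N, 0 ≤ walk F j) (i : Fin N) :
    ∃ p : Fin N, IsOwner F i p := by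
  classical
  let s := (range (i+1)).filter (fun j => walk F j ≤ walk F (i+1))
  have hs : s.Nonempty := ⟨0, by
    have := hF (i+1) (by omega)
    simp only [s, mem_filter, mem_range]
    refine ⟨by omega, ?_⟩
    simpa [walk] using this⟩
  have h1 := s.max'_mem hs
  have h2 : ∀ l ∈ s, l ≤ s.max' hs := fun l hl => s.le_max' l hl
  generalize s.max' hs = p at h1 h2
  simp only [s, mem_filter, mem_range] at h1 h2
  refine ⟨⟨p, by omega⟩, by simp only; omega, h1.2, ?_⟩
  intro l hl hli
  by_contra hc
  have := h2 l ⟨by omega, by omega⟩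
  simp only at hl
  omega

theorem exists_enc (F : ℕ → ℕ) (hF : ∀ j ≤ N, 0 ≤ walk F j) (hN : walk F N = 0) :
    ∃ π : Finpartition (Finset.univ : Finset (Fin N)), IsNoncrossing π ∧
      ∀ j < N, enc π j = F j := by
  classical
  choose own hown using exists_owner F hF
  have own_own : ∀ i, own (own i) = own i := by
    intro i
    apply Fin.ext
    obtain ⟨a, b, c⟩ := hown i
    apply (hown (own i)).unique
    refine ⟨le_rfl, ?_, fun l h1 h2 => by omega⟩
    rcases eq_or_lt_of_le a with h | h
    · rw [h] at b ⊢; exact b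
    · have := c (own i + 1) (by omega) (by omega); omega
  let π : Finpartition (Finset.univ : Finset (Fin N)) := Finpartition.ofSetoid (Setoid.ker own)
  have hpart : ∀ i x, x ∈ π.part i ↔ own i = own x := by
    intro i x
    exact Finpartition.mem_part_ofSetoid_iff_rel
  have hmn : ∀ i, mn π i = own i := by
    intro i
    apply le_antisymm
    · apply Finset.min'_le
      rw [hpart, own_own]
    · have := mn_mem π i
      rw [hpart] at this
      rw [this]
      exact (hown _).1
  have hle : ∀ j ∈ range N, enc π j ≤ F j := by
    intro j hj
    rw [mem_range] at hj
    by_cases h0 : enc π j = 0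
    · omega
    unfold enc at h0 ⊢
    simp_rw [hmn] at h0 ⊢
    have hb : walk F (j+1) = walk F j + F j - 1 := walk_succ F j
    have : #{x | (own x : ℕ) = j} ≤ #(Finset.Icc (walk F j) (walk F (j+1))) := by
      apply Finset.card_le_card_of_injOn (fun x : Fin N => walk F ((x : ℕ)+1))
      · intro x hx
        simp only [coe_filter, mem_univ, true_and, Set.mem_ofPred_eq] at hx
        obtain ⟨a, b, c⟩ := hown x
        rw [hx] at a b c
        simp only [coe_Icc, Set.mem_Icc]
        refine ⟨b, ?_⟩
        rcases eq_or_lt_of_le a with h | h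
        · rw [h]
        · have := c (j + 1) (by omega) (by omega); omega
      · have key : ∀ x y : Fin N, (own x : ℕ) = j → (own y : ℕ) = j → x < y →
            walk F (y+1) < walk F (x+1) := by
          intro x y hx hy hxy
          obtain ⟨a, b, c⟩ := hown x
          obtain ⟨a', b', c'⟩ := hown y
          rw [Fin.lt_def] at hxy
          exact c' (x+1) (by omega) (by omega)
        intro x hx y hy hxy
        simp only [coe_filter, mem_univ, true_and, Set.mem_ofPred_eq] at hx hy hxy
        rcases lt_trichotomy x y with h | h | h
        · have := key x y hx hy h; omega
        · exact h
        · have := key y x hy hx h; omega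
    rw [Int.card_Icc] at this
    omega
  refine ⟨π, ?_, ?_⟩
  · intro a b c d hab hbc hcd B hB C hC ha hc hb hd
    rw [← π.part_eq_of_mem hB ha, ← π.part_eq_of_mem hC hb]
    have e1 : own a = own c := by
      rw [← hpart, π.part_eq_of_mem hB ha]; exact hc
    have e2 : own b = own d := by
      rw [← hpart, π.part_eq_of_mem hC hb]; exact hd
    rw [← mn_eq_iff, hmn, hmn]
    obtain ⟨a1, a2, a3⟩ := hown a
    obtain ⟨b1, b2, b3⟩ := hown b
    obtain ⟨c1, c2, c3⟩ := hown c
    obtain ⟨d1, d2, d3⟩ := hown d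
    rw [← e1] at c1 c2 c3
    rw [← e2] at d1 d2 d3
    rw [Fin.lt_def] at hab hbc hcd
    rcases lt_trichotomy (own a) (own b) with h | h | h
    · rw [Fin.lt_def] at h
      have u := c3 (own b) h (by omega)
      have v := d3 (c+1) (by omega) (by omega)
      omega
    · exact h
    · rw [Fin.lt_def] at h
      have u := b3 (own a) h (by omega)
      have v := c3 (b+1) (by omega) (by omega)
      omega
  · have hsum : ∑ j ∈ range N, enc π j = ∑ j ∈ range N, F j := by
      rw [sum_enc]
      have : ∑ j ∈ range N, F j = N := by
        unfold walk at hN; omega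
      rw [this]
      simp
    intro j hj
    exact (Finset.sum_eq_sum_iff_of_le hle).1 hsum j (mem_range.2 hj)

end

theorem enc_dvd {N k : ℕ} (π : Finpartition (Finset.univ : Finset (Fin N)))
    (h : ∀ B ∈ π.parts, k ∣ B.card) (j : ℕ) : k ∣ enc π j := by
  by_cases h0 : enc π j = 0
  · rw [h0]; exact dvd_zero k
  · have : ({x : Fin N | (mn π x : ℕ) = j} : Finset (Fin N)).Nonempty := by
      rw [← Finset.card_pos]; exact Nat.pos_of_ne_zero h0
    obtain ⟨x, hx⟩ := this
    simp only [mem_filter, mem_univ, true_and] at hx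
    rw [← hx, enc_mn]
    exact h _ (π.part_mem.2 (mem_univ x))

theorem enc_ge {N : ℕ} (π : Finpartition (Finset.univ : Finset (Fin N))) (j : ℕ) (hj : N ≤ j) :
    enc π j = 0 := by
  unfold enc
  rw [Finset.card_eq_zero, Finset.filter_eq_empty_iff]
  intro x _
  omega

/-- Block sizes divided by `k`, as a function on `ZMod (N+1)`. -/
def gcode {N : ℕ} (k : ℕ) (π : Finpartition (Finset.univ : Finset (Fin N))) :
    ZMod (N+1) → ℕ := fun z => enc π z.val / k

theorem gcode_cast {N k : ℕ} (π : Finpartition (Finset.univ : Finset (Fin N)))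
    (h : ∀ B ∈ π.parts, k ∣ B.card) (j : ℕ) (hj : j ≤ N) :
    k * gcode k π (j : ZMod (N+1)) = enc π j := by
  unfold gcode
  rw [ZMod.val_natCast_of_lt (by omega)]
  exact Nat.mul_div_cancel' (enc_dvd π h j)

theorem gcode_sum {N k : ℕ} (π : Finpartition (Finset.univ : Finset (Fin N)))
    (h : ∀ B ∈ π.parts, k ∣ B.card) (j : ℕ) (hj : j ≤ N + 1) :
    k * ∑ i ∈ range j, gcode k π (i : ZMod (N+1)) = ∑ i ∈ range j, enc π i := by
  rw [mul_sum]
  apply sum_congr rfl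
  intro i hi
  rw [mem_range] at hi
  exact gcode_cast π h i (by omega)

theorem gcode_count {N k t : ℕ} (hk : 1 ≤ k) (ht : 1 ≤ t)
    (π : Finpartition (Finset.univ : Finset (Fin N)))
    (h : ∀ B ∈ π.parts, k ∣ B.card) :
    blockCount π (t * k) = #{z | gcode k π z = t} := by
  let s : Finset (Fin N) := {x | mn π x = x ∧ #(π.part x) = t * k}
  have h1 : #s = blockCount π (t * k) := by
    unfold blockCount
    apply Finset.card_bij (fun x _ => π.part x)
    · intro x hx
      simp only [s, mem_filter, mem_univ, true_and] at hx
      rw [mem_filter]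
      exact ⟨π.part_mem.2 (mem_univ x), hx.2⟩
    · intro x hx y hy hxy
      simp only [s, mem_filter, mem_univ, true_and] at hx hy
      rw [← hx.1, ← hy.1]
      exact mn_congr π hxy
    · intro B hB
      rw [mem_filter] at hB
      obtain ⟨x, hx⟩ := π.nonempty_of_mem_parts hB.1
      have hpx := π.part_eq_of_mem hB.1 hx
      refine ⟨mn π x, ?_, ?_⟩
      · simp only [s, mem_filter, mem_univ, true_and]
        rw [mn_mn, part_mn, hpx]
        exact ⟨rfl, hB.2⟩
      · rw [part_mn, hpx]
  rw [← h1]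
  apply Finset.card_bij (fun (x : Fin N) _ => ((x : ℕ) : ZMod (N+1)))
  · intro x hx
    simp only [s, mem_filter, mem_univ, true_and] at hx ⊢
    have e := gcode_cast π h x (by omega)
    have e2 := enc_mn π x
    rw [hx.1, ← e, hx.2, mul_comm t k] at e2
    exact Nat.eq_of_mul_eq_mul_left (by omega) e2
  · intro x hx y hy hxy
    have := congrArg ZMod.val hxy
    rw [ZMod.val_natCast_of_lt (by omega), ZMod.val_natCast_of_lt (by omega)] at this
    exact Fin.ext this
  · intro z hz
    simp only [mem_filter, mem_univ, true_and] at hz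
    have hzl := z.val_lt
    have e := gcode_cast π h z.val (by omega)
    rw [ZMod.natCast_zmod_val, hz] at e
    have hpos : 0 < enc π z.val := by rw [← e]; positivity
    have : ({x : Fin N | (mn π x : ℕ) = z.val} : Finset (Fin N)).Nonempty := by
      rw [← Finset.card_pos]; exact hpos
    obtain ⟨x, hx⟩ := this
    simp only [mem_filter, mem_univ, true_and] at hx
    refine ⟨mn π x, ?_, ?_⟩
    · simp only [s, mem_filter, mem_univ, true_and]
      rw [mn_mn, part_mn, ← enc_mn, hx, ← e, mul_comm]
      exact ⟨rfl, rfl⟩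
    · rw [hx, ZMod.natCast_zmod_val]

theorem mem_NCdiv {k n : ℕ} (π : Finpartition (Finset.univ : Finset (Fin (k * n)))) :
    π ∈ NCdiv k n ↔ IsNoncrossing π ∧ ∀ B ∈ π.parts, k ∣ B.card := by
  simp [NCdiv, fil]

/-- **Theorem 1.** The sum of the number of blocks of size `tk` over all the `k`-divisible
non-crossing partitions of `{1,…,kn}` is `binom(n(k+1) - t - 1, nk - 1)`. -/
theorem sum_blockCount_k_divisible (n k t : ℕ) (hn : 1 ≤ n) (hk : 1 ≤ k)
    (ht1 : 1 ≤ t) (htn : t ≤ n) :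
    ∑ π ∈ NCdiv k n, blockCount π (t * k) =
      Nat.choose (n * (k + 1) - t - 1) (n * k - 1) := by
  classical
  have hfin := count_valid (k * n) n k t rfl (Nat.mul_pos hk hn) htn
  rw [show n * (k + 1) = k * n + n by ring, show n * k = k * n by ring, ← hfin]
  apply Finset.sum_bij (fun π _ => gcode k π)
  · intro π hπ
    rw [mem_NCdiv] at hπ
    rw [mem_filter, mem_piAntidiag]
    refine ⟨⟨?_, by simp⟩, ?_⟩
    · rw [sum_zmod]
      have e := gcode_sum π hπ.2 (k * n + 1) le_rfl
      rw [sum_enc] at e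
      apply Nat.eq_of_mul_eq_mul_left hk
      rw [e, Finset.filter_true_of_mem]
      · simp
      · intro x _; omega
    · intro j hj
      rw [gcode_sum π hπ.2 j (by omega)]
      have := walk_enc π j hj
      unfold walk at this
      omega
  · intro π hπ π' hπ' he
    rw [mem_NCdiv] at hπ hπ'
    apply enc_inj hπ.1 hπ'.1
    funext j
    by_cases hj : j ≤ k * n
    · rw [← gcode_cast π hπ.2 j hj, ← gcode_cast π' hπ'.2 j hj, he]
    · rw [enc_ge π j (by omega), enc_ge π' j (by omega)]
  · intro g hg
    rw [mem_filter, mem_piAntidiag, sum_zmod, sum_range_succ] at hg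
    obtain ⟨⟨hs, -⟩, hv⟩ := hg
    have hN := hv (k * n) le_rfl
    have hN' : n ≤ ∑ i ∈ range (k * n), g (i : ZMod (k * n + 1)) := Nat.le_of_mul_le_mul_left hN hk
    have hlast : g ((k * n : ℕ) : ZMod (k * n + 1)) = 0 := by omega
    have hsum : ∑ i ∈ range (k * n), g (i : ZMod (k * n + 1)) = n := by omega
    have hw : ∀ j, walk (fun j => k * g (j : ZMod (k * n + 1))) j =
        ((k * ∑ i ∈ range j, g (i : ZMod (k * n + 1)) : ℕ) : ℤ) - j := by
      intro j
      unfold walk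
      rw [mul_sum]
    obtain ⟨π, h1, h2⟩ := exists_enc (N := k * n) (fun j => k * g (j : ZMod (k * n + 1)))
      (fun j hj => by have := hv j hj; rw [hw]; omega) (by rw [hw, hsum]; omega)
    have hd : ∀ B ∈ π.parts, k ∣ B.card := by
      intro B hB
      obtain ⟨x, hx⟩ := π.nonempty_of_mem_parts hB
      rw [← π.part_eq_of_mem hB hx, ← enc_mn, h2 _ (mn π x).isLt]
      exact dvd_mul_right _ _
    refine ⟨π, (mem_NCdiv π).2 ⟨h1, hd⟩, ?_⟩
    funext z
    have hz := z.val_lt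
    have e := gcode_cast π hd z.val (by omega)
    apply Nat.eq_of_mul_eq_mul_left hk
    rw [ZMod.natCast_zmod_val] at e
    rw [e]
    by_cases hzl : z.val < k * n
    · rw [h2 _ hzl]
      simp only [ZMod.natCast_zmod_val]
    · have hzv : z.val = k * n := by omega
      rw [enc_ge π _ (by omega)]
      have hz2 : ((k * n : ℕ) : ZMod (k * n + 1)) = z := by
        have := congrArg (Nat.cast : ℕ → ZMod (k * n + 1)) hzv
        rw [ZMod.natCast_zmod_val] at this
        exact this.symm
      rw [hz2] at hlast
      rw [hlast, mul_zero]
  · intro π hπ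
    rw [mem_NCdiv] at hπ
    exact gcode_count hk ht1 π hπ.2
end
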